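/- arXiv:2005.01466 — 2 statements merged into one kernel-verified Lean document; each statement's English description precedes it below -/
import Mathlib

section
/- Let D be a strongly connected balanced bipartite digraph of order 2a with a ≥ 2, such that d(u)+d(v) ≥ 3a for every pair of distinct non-adjacent vertices u,v. Then D is Hamiltonian. -/
open Finset Function

variable {V : Type*}

/-- Out-degree of a vertex in a digraph given by arc relation `A`. -/
noncomputable def outDeg (A : V → V → Prop) (u : V) : ℕ := {v | A u v}.ncard

/-- In-degree of a vertex. -/
noncomputable def inDeg (A : V → V → Prop) (u : V) : ℕ := {v | A v u}.ncard

/-- Degree `d(u) = d⁺(u) + d⁻(u)`. -/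
noncomputable def deg (A : V → V → Prop) (u : V) : ℕ := outDeg A u + inDeg A u

/-- Strong connectedness: a directed path between every ordered pair of vertices. -/
def StronglyConnected (A : V → V → Prop) : Prop :=
  ∀ u v : V, Relation.ReflTransGen A u v

/-- `X, Y` form a bipartition of the digraph `A`. -/
def IsBipartition (A : V → V → Prop) (X Y : Set V) : Prop :=
  Disjoint X Y ∧ X ∪ Y = Set.univ ∧
    ∀ u v, A u v → (u ∈ X ∧ v ∈ Y) ∨ (u ∈ Y ∧ v ∈ X)

/-- `{u,v}` is a dominating pair: a common out-neighbour exists. -/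
def IsDominatingPair (A : V → V → Prop) (u v : V) : Prop :=
  u ≠ v ∧ ∃ w, A u w ∧ A v w

/-- `{u,v}` is a dominated pair: a common in-neighbour exists. -/
def IsDominatedPair (A : V → V → Prop) (u v : V) : Prop :=
  u ≠ v ∧ ∃ w, A w u ∧ A w v

/-- The digraph contains a directed cycle of length `l`. -/
def HasCycleOfLength (A : V → V → Prop) (l : ℕ) : Prop :=
  ∃ f : ZMod l → V, Function.Injective f ∧ ∀ i, A (f i) (f (i + 1))

/-- The digraph contains a Hamiltonian (directed) cycle. -/
def IsHamiltonian [Fintype V] (A : V → V → Prop) : Prop :=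
  ∃ f : ZMod (Fintype.card V) ≃ V, ∀ i, A (f i) (f (i + 1))

/-- The digraph is exactly one directed cycle through all its vertices. -/
def IsDirectedCycleDigraph [Fintype V] (A : V → V → Prop) : Prop :=
  ∃ f : ZMod (Fintype.card V) ≃ V, ∀ u v, A u v ↔ ∃ i, u = f i ∧ v = f (i + 1)

/-- A balanced bipartite digraph of order `2a` is bipancyclic: it has cycles of
all even lengths `2, 4, …, 2a`. -/
def Bipancyclic [Fintype V] (A : V → V → Prop) (a : ℕ) : Prop :=
  ∀ l, 1 ≤ l → l ≤ a → HasCycleOfLength A (2 * l)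

/-- A digraph is pancyclic: cycles of all lengths `2, …, n`. -/
def Pancyclic [Fintype V] (A : V → V → Prop) : Prop :=
  ∀ l, 2 ≤ l → l ≤ Fintype.card V → HasCycleOfLength A l

/-- A cycle factor: a spanning collection of vertex-disjoint directed cycles,
i.e. a permutation `σ` with `v → σ v` an arc for every `v` (in a loopless
digraph all orbits have length `≥ 2`). -/
def HasCycleFactor (A : V → V → Prop) : Prop :=
  ∃ σ : Equiv.Perm V, ∀ v, A v (σ v)

/-- `arcs(S,T) = |A[S,T]| + |A[T,S]|`. -/
noncomputable def arcsCount (A : V → V → Prop) (S T : Set V) : ℕ :=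
  {p : V × V | p.1 ∈ S ∧ p.2 ∈ T ∧ A p.1 p.2}.ncard +
  {p : V × V | p.1 ∈ T ∧ p.2 ∈ S ∧ A p.1 p.2}.ncard

theorem IsBipartition.symm {A : V → V → Prop} {X Y : Set V} (h : IsBipartition A X Y) :
    IsBipartition A Y X :=
  ⟨h.1.symm, by rw [Set.union_comm]; exact h.2.1, fun u v huv => (h.2.2 u v huv).symm⟩

theorem IsBipartition.mem_right_iff {A : V → V → Prop} {X Y : Set V} (h : IsBipartition A X Y)
    (v : V) : v ∈ Y ↔ v ∉ X := by
  have h1 : v ∈ X ∪ Y := h.2.1 ▸ Set.mem_univ v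
  exact ⟨fun hy hx => Set.disjoint_left.1 h.1 hx hy, fun hx => h1.resolve_left hx⟩

theorem IsBipartition.head_mem_iff {A : V → V → Prop} {X Y : Set V} (h : IsBipartition A X Y)
    {u v : V} (huv : A u v) : v ∈ Y ↔ u ∈ X := by
  have h1 := h.mem_right_iff u
  have h2 := h.mem_right_iff v
  have h3 := h.2.2 u v huv
  tauto

theorem IsBipartition.not_arc {A : V → V → Prop} {X Y : Set V} (h : IsBipartition A X Y)
    {u v : V} (hu : u ∈ X) (hv : v ∈ X) : ¬ A u v := fun huv =>
  (h.mem_right_iff v).1 ((h.head_mem_iff huv).2 hu) hv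

theorem IsBipartition.outNbrs_subset {A : V → V → Prop} {X Y : Set V} (h : IsBipartition A X Y)
    {u : V} (hu : u ∈ X) : {v | A u v} ⊆ Y := fun _ hv => (h.head_mem_iff hv).2 hu

theorem IsBipartition.inNbrs_subset {A : V → V → Prop} {X Y : Set V} (h : IsBipartition A X Y)
    {u : V} (hu : u ∈ X) : {v | A v u} ⊆ Y := fun _ hv => (h.symm.head_mem_iff hv).1 hu

theorem StronglyConnected.exists_outNbr {A : V → V → Prop} [Nontrivial V]
    (h : StronglyConnected A) (u : V) : ∃ v, A u v := by
  obtain ⟨w, hw⟩ := exists_ne u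
  obtain h1 | ⟨v, hv, -⟩ := (h u w).cases_head
  · exact absurd h1.symm hw
  · exact ⟨v, hv⟩

theorem StronglyConnected.exists_inNbr {A : V → V → Prop} [Nontrivial V]
    (h : StronglyConnected A) (u : V) : ∃ v, A v u := by
  obtain ⟨w, hw⟩ := exists_ne u
  obtain h1 | ⟨v, -, hv⟩ := (h w u).cases_tail
  · exact absurd h1.symm hw
  · exact ⟨v, hv⟩

/-- A strongly connected digraph has an arc leaving every nonempty proper vertex set. -/
theorem StronglyConnected.exists_arc_leaving {A : V → V → Prop} (h : StronglyConnected A)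
    {C : Set V} {u w : V} (hu : u ∈ C) (hw : w ∉ C) : ∃ x ∈ C, ∃ y ∉ C, A x y := by
  by_contra! hcon
  have hmem : ∀ z, Relation.ReflTransGen A u z → z ∈ C := by
    intro z hz
    induction hz with
    | refl => exact hu
    | tail _ hbc ih => by_contra hc; exact hcon _ ih _ hc hbc
  exact hw (hmem w (h u w))

/-- Hall's condition for the out-neighbourhoods of vertex sets inside one partite set. -/
theorem ncard_le_ncard_outNbrs [Finite V] [Nontrivial V] {A : V → V → Prop} {a : ℕ} {X Y : Set V}
    (hbip : IsBipartition A X Y) (hX : X.ncard = a) (hY : Y.ncard = a)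
    (hsc : StronglyConnected A)
    (hdeg : ∀ u v : V, u ≠ v → ¬ A u v → ¬ A v u → 3 * a ≤ deg A u + deg A v)
    {S : Set V} (hS : S ⊆ X) : S.ncard ≤ {v | ∃ u ∈ S, A u v}.ncard := by
  set N : Set V := {v | ∃ u ∈ S, A u v} with hN
  by_contra! hlt
  have hNY : N ⊆ Y := fun v ⟨u, hu, huv⟩ => (hbip.head_mem_iff huv).2 (hS hu)
  have hSX : S.ncard ≤ a := hX ▸ Set.ncard_le_ncard hS
  have hdX : ∀ u ∈ S, deg A u ≤ N.ncard + a := fun u hu =>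
    add_le_add (Set.ncard_le_ncard fun v hv => ⟨u, hu, hv⟩)
      (hY ▸ Set.ncard_le_ncard (hbip.inNbrs_subset (hS hu)))
  have hNne : 0 < N.ncard := by
    obtain ⟨u, hu⟩ : S.Nonempty := (Set.ncard_pos).1 (by omega)
    obtain ⟨v, hv⟩ := hsc.exists_outNbr u
    exact (Set.ncard_pos).2 ⟨v, u, hu, hv⟩
  obtain ⟨u, hu, v, hv, huv⟩ := (Set.one_lt_ncard (s := S)).1 (by omega)
  have h1 := hdeg u v huv (hbip.not_arc (hS hu) (hS hv)) (hbip.not_arc (hS hv) (hS hu))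
  have h2 := hdX u hu
  have h3 := hdX v hv
  have hin : ∀ y ∈ Y \ N, {x | A x y} ⊆ X \ S := fun y hy x hx =>
    ⟨hbip.symm.inNbrs_subset hy.1 hx, fun hxS => hy.2 ⟨x, hxS, hx⟩⟩
  have hXS : (X \ S).ncard = a - S.ncard := by rw [Set.ncard_sdiff hS, hX]
  have hYN : (Y \ N).ncard = a - N.ncard := by rw [Set.ncard_sdiff hNY, hY]
  have hpos : 0 < (X \ S).ncard := by
    obtain ⟨y, hy⟩ : (Y \ N).Nonempty := (Set.ncard_pos).1 (by omega)
    obtain ⟨x, hx⟩ := hsc.exists_inNbr y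
    exact (Set.ncard_pos).2 ⟨x, hin y hy hx⟩
  have hdY : ∀ y ∈ Y \ N, deg A y ≤ a + (a - S.ncard) := fun y hy =>
    add_le_add (hX ▸ Set.ncard_le_ncard (hbip.symm.outNbrs_subset hy.1))
      (hXS ▸ Set.ncard_le_ncard (hin y hy))
  obtain ⟨y, hy, z, hz, hyz⟩ := (Set.one_lt_ncard (s := Y \ N)).1 (by omega)
  have h4 := hdeg y z hyz (hbip.symm.not_arc hy.1 hz.1) (hbip.symm.not_arc hz.1 hy.1)
  have h5 := hdY y hy
  have h6 := hdY z hz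
  omega

theorem hasCycleFactor_of_meyniel [Finite V] [Nontrivial V] {A : V → V → Prop} {a : ℕ}
    {X Y : Set V} (hbip : IsBipartition A X Y) (hX : X.ncard = a) (hY : Y.ncard = a)
    (hsc : StronglyConnected A)
    (hdeg : ∀ u v : V, u ≠ v → ¬ A u v → ¬ A v u → 3 * a ≤ deg A u + deg A v) :
    HasCycleFactor A := by
  classical
  have := Fintype.ofFinite V
  obtain ⟨f, hf, hfA⟩ := (Finset.all_card_le_biUnion_card_iff_exists_injective
    (fun u : V => (Finset.univ.filter fun v => A u v))).1 (by
      intro s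
      have h1 := ncard_le_ncard_outNbrs hbip hX hY hsc hdeg (S := ↑s ∩ X) Set.inter_subset_right
      have h2 := ncard_le_ncard_outNbrs hbip.symm hY hX hsc hdeg (S := ↑s ∩ Y)
        Set.inter_subset_right
      have hdisj : Disjoint {v | ∃ u ∈ (↑s ∩ X : Set V), A u v}
          {v | ∃ u ∈ (↑s ∩ Y : Set V), A u v} := by
        rw [Set.disjoint_left]
        rintro v ⟨u, hu, huv⟩ ⟨w, hw, hwv⟩
        exact (hbip.mem_right_iff v).1 ((hbip.head_mem_iff huv).2 hu.2)
          ((hbip.symm.head_mem_iff hwv).2 hw.2)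
      have h3 := Set.ncard_union_eq hdisj
      have h4 : (s : Set V).ncard = (↑s ∩ X : Set V).ncard + (↑s ∩ Y : Set V).ncard := by
        rw [← Set.ncard_union_eq (hbip.1.mono Set.inter_subset_right Set.inter_subset_right),
          ← Set.inter_union_distrib_left, hbip.2.1, Set.inter_univ]
      rw [← Set.ncard_coe_finset, h4]
      refine (add_le_add h1 h2).trans ?_
      rw [← h3, ← Set.ncard_coe_finset]
      refine Set.ncard_le_ncard ?_
      rintro v (⟨u, hu, huv⟩ | ⟨u, hu, huv⟩) <;> simpa using ⟨u, hu.1, huv⟩)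
  exact ⟨Equiv.ofBijective f (Finite.injective_iff_bijective.1 hf), fun v => by
    simpa using hfA v⟩

theorem sameCycle_mul_swap [Finite V] [DecidableEq V] {σ : Equiv.Perm V} {u v : V}
    (huv : ¬ σ.SameCycle u v) : (σ * Equiv.swap u v).SameCycle u v := by
  set τ := σ * Equiv.swap u v with hτ
  have hτu : τ u = σ v := by simp [hτ]
  have key : ∀ k : ℕ, τ.SameCycle u ((σ ^ (k + 1)) v) ∨ τ.SameCycle u v := by
    intro k
    induction k with
    | zero => left; simp [← hτu, Equiv.Perm.SameCycle.refl]
    | succ k ih =>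
      rcases ih with ih | ih
      · by_cases hw : (σ ^ (k + 1)) v = v
        · right; rwa [hw] at ih
        · left
          have hwu : (σ ^ (k + 1)) v ≠ u := fun h => huv (h ▸ by
            exact (Equiv.Perm.sameCycle_pow_left).2 (Equiv.Perm.SameCycle.refl σ v))
          have hstep : (σ ^ (k + 1 + 1)) v = τ ((σ ^ (k + 1)) v) := by
            rw [pow_succ' σ (k + 1), hτ, Equiv.Perm.mul_apply, Equiv.Perm.mul_apply,
              Equiv.swap_apply_of_ne_of_ne hwu hw]
          rw [hstep]
          exact Equiv.Perm.sameCycle_apply_right.2 ih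
      · exact Or.inr ih
  have hpos := orderOf_pos σ
  have h := key (orderOf σ - 1)
  rw [Nat.sub_add_cancel hpos, pow_orderOf_eq_one] at h
  simpa using h

theorem sameCycle_mul_swap_of_sameCycle [Finite V] [DecidableEq V] {σ : Equiv.Perm V} {u v : V}
    (huv : ¬ σ.SameCycle u v) {x y : V} (hxy : σ.SameCycle x y) :
    (σ * Equiv.swap u v).SameCycle x y := by
  have hmerge := sameCycle_mul_swap huv
  set τ := σ * Equiv.swap u v with hτ
  have hτu : τ u = σ v := by simp [hτ]
  have hτv : τ v = σ u := by simp [hτ]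
  have step : ∀ w, τ.SameCycle w (σ w) := by
    intro w
    by_cases h1 : w = u
    · subst h1
      rw [← hτv]
      exact Equiv.Perm.sameCycle_apply_right.2 hmerge
    · by_cases h2 : w = v
      · subst h2
        rw [← hτu]
        exact Equiv.Perm.sameCycle_apply_right.2 hmerge.symm
      · have : σ w = τ w := by
          rw [hτ, Equiv.Perm.mul_apply, Equiv.swap_apply_of_ne_of_ne h1 h2]
        rw [this]
        exact Equiv.Perm.sameCycle_apply_right.2 (Equiv.Perm.SameCycle.refl τ w)
  obtain ⟨n, rfl⟩ := hxy.exists_nat_pow_eq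
  clear hxy
  induction n with
  | zero => exact Equiv.Perm.SameCycle.refl τ x
  | succ n ih =>
    rw [pow_succ', Equiv.Perm.mul_apply]
    exact ih.trans (step _)

/-- `σ` is a cycle factor of `A` in which as many pairs of vertices as possible
share a cycle. -/
def IsMaxCycleFactor (A : V → V → Prop) (σ : Equiv.Perm V) : Prop :=
  (∀ v, A v (σ v)) ∧ ∀ τ : Equiv.Perm V, (∀ v, A v (τ v)) →
    {p : V × V | τ.SameCycle p.1 p.2}.ncard ≤ {p : V × V | σ.SameCycle p.1 p.2}.ncard

theorem HasCycleFactor.exists_isMaxCycleFactor [Finite V] {A : V → V → Prop}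
    (h : HasCycleFactor A) : ∃ σ, IsMaxCycleFactor A σ := by
  obtain ⟨σ, hσ, hmax⟩ := Set.exists_max_image {σ : Equiv.Perm V | ∀ v, A v (σ v)}
    (fun σ => {p : V × V | σ.SameCycle p.1 p.2}.ncard) (Set.toFinite _) h
  exact ⟨σ, hσ, hmax⟩

theorem IsMaxCycleFactor.not_arc_and_arc [Finite V] {A : V → V → Prop} {σ : Equiv.Perm V}
    (h : IsMaxCycleFactor A σ) {u v : V} (huv : ¬ σ.SameCycle u v) :
    ¬ (A u (σ v) ∧ A v (σ u)) := by
  classical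
  rintro ⟨h1, h2⟩
  refine absurd (h.2 (σ * Equiv.swap u v) fun w => ?_) (not_le.2 ?_)
  · rw [Equiv.Perm.mul_apply, Equiv.swap_apply_def]
    split_ifs with hu hv
    · exact hu ▸ h1
    · exact hv ▸ h2
    · exact h.1 w
  · refine Set.ncard_lt_ncard ⟨fun p hp => sameCycle_mul_swap_of_sameCycle huv hp, fun hsub => ?_⟩
    exact huv (hsub (a := (u, v)) (sameCycle_mul_swap huv))

theorem IsMaxCycleFactor.conj [Finite V] {A : V → V → Prop} {σ : Equiv.Perm V}
    (h : IsMaxCycleFactor A σ) (τ : Equiv.Perm V) (hτ : ∀ v, A v ((τ * σ * τ⁻¹) v)) :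
    IsMaxCycleFactor A (τ * σ * τ⁻¹) := by
  refine ⟨hτ, fun ρ hρ => (h.2 ρ hρ).trans_eq ?_⟩
  rw [← Set.ncard_preimage_of_injective_subset_range
    (Equiv.prodCongr τ⁻¹ τ⁻¹).injective (by simp)]
  congr 1
  ext p
  simp [Equiv.Perm.sameCycle_conj]

theorem isHamiltonian_of_sameCycle [Fintype V] [Nonempty V] {A : V → V → Prop}
    {σ : Equiv.Perm V} (hσ : ∀ v, A v (σ v)) (hall : ∀ u v, σ.SameCycle u v) :
    IsHamiltonian A := by
  classical
  obtain ⟨u⟩ := ‹Nonempty V›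
  have hcyc : σ.IsCycleOn ((Finset.univ : Finset V) : Set V) :=
    ⟨by simp, fun x _ y _ => hall x y⟩
  have hpos : NeZero (Fintype.card V) := ⟨Fintype.card_ne_zero⟩
  let f : ZMod (Fintype.card V) → V := fun i => (σ ^ i.val) u
  have hf : ∀ n : ℕ, f (n : ZMod (Fintype.card V)) = (σ ^ n) u := by
    intro n
    refine (hcyc.pow_apply_eq_pow_apply (Finset.mem_univ u)).2 ?_
    rw [ZMod.val_natCast]
    exact Nat.mod_modEq _ _
  have hsurj : Function.Surjective f := fun v => by
    obtain ⟨n, -, hn⟩ := hcyc.exists_pow_eq (Finset.mem_univ u) (Finset.mem_univ v)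
    exact ⟨n, (hf n).trans hn⟩
  have hbij : Function.Bijective f :=
    (Fintype.bijective_iff_surjective_and_card f).2 ⟨hsurj, ZMod.card _⟩
  refine ⟨Equiv.ofBijective f hbij, fun i => ?_⟩
  have h1 : f (i + 1) = σ (f i) := by
    conv_lhs => rw [← ZMod.natCast_zmod_val i, ← Nat.cast_one, ← Nat.cast_add, hf]
    rw [add_comm, pow_add, pow_one]
    rfl
  simpa [h1] using hσ (f i)

theorem mem_of_sameCycle {σ : Equiv.Perm V} {C : Set V} (hC : ∀ v, σ v ∈ C ↔ v ∈ C) [Finite V]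
    {u v : V} (h : σ.SameCycle u v) (hu : u ∈ C) : v ∈ C := by
  obtain ⟨n, rfl⟩ := h.exists_nat_pow_eq
  clear h
  induction n with
  | zero => simpa using hu
  | succ n ih => rw [pow_succ', Equiv.Perm.mul_apply]; exact (hC _).2 ih

theorem swap_apply_mem_iff [DecidableEq V] {S : Set V} {p q : V} (h : p ∈ S ↔ q ∈ S) (x : V) :
    Equiv.swap p q x ∈ S ↔ x ∈ S := by
  rw [Equiv.swap_apply_def]
  split_ifs with h1 h2
  · rw [h1, h]
  · rw [h2, h]
  · rfl

theorem ncard_inter_eq_of_invariant [Finite V] {A : V → V → Prop} {X Y C : Set V}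
    {σ : Equiv.Perm V} (hbip : IsBipartition A X Y) (hσ : ∀ v, A v (σ v))
    (hC : ∀ v, σ v ∈ C ↔ v ∈ C) : (C ∩ Y).ncard = (C ∩ X).ncard := by
  rw [← Set.ncard_image_of_injective (C ∩ X) σ.injective]
  congr 1
  ext y
  constructor
  · intro hy
    have h1 := hσ (σ.symm y)
    have h2 := hC (σ.symm y)
    rw [Equiv.apply_symm_apply] at h1 h2
    exact ⟨σ.symm y, ⟨h2.1 hy.1, (hbip.head_mem_iff h1).1 hy.2⟩, by simp⟩
  · rintro ⟨x, hx, rfl⟩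
    exact ⟨(hC x).2 hx.1, (hbip.head_mem_iff (hσ x)).2 hx.2⟩

/-- If `C` and its complement both induce complete bipartite digraphs, then the arcs leaving `C`
and the arcs entering `C` have their tails in different partite sets. -/
theorem IsMaxCycleFactor.not_crossing [Finite V] {A : V → V → Prop} {X Y C : Set V}
    {σ : Equiv.Perm V} (hbip : IsBipartition A X Y) (h : IsMaxCycleFactor A σ)
    (hC : ∀ v, σ v ∈ C ↔ v ∈ C)
    (hcomp : ∀ u v, (u ∈ C ↔ v ∈ C) → (v ∈ X ↔ u ∉ X) → A u v)
    {u v w z : V} (hu : u ∈ C) (hv : v ∉ C) (hw : w ∉ C) (hz : z ∈ C) (huw : u ∈ X ↔ w ∈ X)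
    (huv : A u v) (hwz : A w z) : False := by
  classical
  have part : ∀ {p q : V}, A p q → (q ∈ X ↔ p ∉ X) := fun {p q} hpq =>
    (hbip.symm.head_mem_iff hpq).trans (hbip.mem_right_iff p)
  set τ : Equiv.Perm V := Equiv.swap (σ u) z * Equiv.swap (σ w) v with hτ
  have hσu := (hC u).2 hu
  have hσw : σ w ∉ C := fun h => hw ((hC w).1 h)
  have hτC : ∀ x, τ x ∈ C ↔ x ∈ C := fun x => by
    rw [hτ, Equiv.Perm.mul_apply, swap_apply_mem_iff (by tauto), swap_apply_mem_iff (by tauto)]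
  have hpu := part (h.1 u)
  have hpw := part (h.1 w)
  have hpv := part huv
  have hpz := part hwz
  have hτX : ∀ x, τ x ∈ X ↔ x ∈ X := fun x => by
    rw [hτ, Equiv.Perm.mul_apply, swap_apply_mem_iff (by tauto), swap_apply_mem_iff (by tauto)]
  have hfix : ∀ x, (x ∈ X ↔ u ∈ X) → τ x = x := fun x hx => by
    have hne : ∀ {p}, (p ∈ X ↔ u ∉ X) → x ≠ p := by
      rintro p hp rfl
      tauto
    rw [hτ, Equiv.Perm.mul_apply, Equiv.swap_apply_of_ne_of_ne (hne (by tauto)) (hne (by tauto)),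
      Equiv.swap_apply_of_ne_of_ne (hne (by tauto)) (hne (by tauto))]
  have hτu : τ (σ u) = z := by
    rw [hτ, Equiv.Perm.mul_apply, Equiv.swap_apply_of_ne_of_ne (ne_of_mem_of_not_mem hσu hσw)
      (ne_of_mem_of_not_mem hσu hv), Equiv.swap_apply_left]
  have hτw : τ (σ w) = v := by
    rw [hτ, Equiv.Perm.mul_apply, Equiv.swap_apply_left, Equiv.swap_apply_of_ne_of_ne
      (ne_of_mem_of_not_mem hσu hv).symm (ne_of_mem_of_not_mem hz hv).symm]
  have happ : ∀ x, (τ * σ * τ⁻¹) (τ x) = τ (σ x) := fun x => by simp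
  have hmax := h.conj τ fun y => by
    obtain ⟨x, rfl⟩ := τ.surjective y
    rw [happ]
    refine hcomp _ _ ?_ ?_
    · rw [hτC, hτC, hC]
    · rw [hτX, hτX, part (h.1 x)]
  have hu' : (τ * σ * τ⁻¹) u = z := by
    have := happ u
    rwa [hfix u Iff.rfl, hτu] at this
  have hw' : (τ * σ * τ⁻¹) w = v := by
    have := happ w
    rwa [hfix w huw.symm, hτw] at this
  have hC' : ∀ y, (τ * σ * τ⁻¹) y ∈ C ↔ y ∈ C := fun y => by
    obtain ⟨x, rfl⟩ := τ.surjective y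
    rw [happ, hτC, hτC, hC]
  refine hmax.not_arc_and_arc (fun hs => hw (mem_of_sameCycle hC' hs hu)) ?_
  rw [hu', hw']
  exact ⟨huv, hwz⟩

theorem IsMaxCycleFactor.false_of_complete_of_mem [Finite V] {A : V → V → Prop} {a : ℕ}
    {X Y C : Set V} {σ : Equiv.Perm V} (ha : 0 < a) (hbip : IsBipartition A X Y)
    (hX : X.ncard = a)
    (hdeg : ∀ u v : V, u ≠ v → ¬ A u v → ¬ A v u → 3 * a ≤ deg A u + deg A v)
    (h : IsMaxCycleFactor A σ) (hC : ∀ v, σ v ∈ C ↔ v ∈ C)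
    (hcomp : ∀ u v, (u ∈ C ↔ v ∈ C) → (v ∈ X ↔ u ∉ X) → A u v)
    {u v w z : V} (hu : u ∈ C) (hv : v ∉ C) (hw : w ∉ C) (hz : z ∈ C) (huX : u ∈ X)
    (hwY : w ∈ Y) (huv : A u v) (hwz : A w z) : False := by
  have hYX := hbip.mem_right_iff
  have hout : ∀ {p q}, p ∈ C → q ∉ C → A p q → p ∈ X := fun {p q} hp hq hpq => by
    by_contra hpX
    exact h.not_crossing hbip hC hcomp hp hq hw hz (iff_of_false hpX ((hYX w).1 hwY)) hpq hwz
  have hin : ∀ {p q}, p ∉ C → q ∈ C → A p q → p ∈ Y := fun {p q} hp hq hpq => by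
    by_contra hpY
    have hpX : p ∈ X := by by_contra h'; exact hpY ((hYX p).2 h')
    exact h.not_crossing hbip hC hcomp hu hv hp hq (iff_of_true huX hpX) huv hpq
  have hyC : σ u ∈ C := (hC u).2 hu
  have hyY : σ u ∈ Y := (hbip.head_mem_iff (h.1 u)).2 huX
  have hxC : σ w ∉ C := fun h' => hw ((hC w).1 h')
  have hxX : σ w ∈ X := (hbip.symm.head_mem_iff (h.1 w)).2 hwY
  have hy1 : {q | A (σ u) q} ⊆ C ∩ X := fun q hq =>
    ⟨by_contra fun hqC => (hYX _).1 hyY (hout hyC hqC hq), hbip.symm.outNbrs_subset hyY hq⟩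
  have hy2 : {q | A q (σ u)} ⊆ C ∩ X := fun q hq =>
    have hqX := hbip.symm.inNbrs_subset hyY hq
    ⟨by_contra fun hqC => (hYX _).1 (hin hqC hyC hq) hqX, hqX⟩
  have hx1 : {q | A (σ w) q} ⊆ Cᶜ ∩ Y := fun q hq =>
    ⟨fun hqC => (hYX _).1 (hin hxC hqC hq) hxX, hbip.outNbrs_subset hxX hq⟩
  have hx2 : {q | A q (σ w)} ⊆ Cᶜ ∩ Y := fun q hq =>
    have hqY := hbip.inNbrs_subset hxX hq
    ⟨fun hqC => (hYX _).1 hqY (hout hqC hxC hq), hqY⟩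
  have hd1 : deg A (σ u) ≤ (C ∩ X).ncard + (C ∩ X).ncard :=
    add_le_add (Set.ncard_le_ncard hy1) (Set.ncard_le_ncard hy2)
  have hd2 : deg A (σ w) ≤ (Cᶜ ∩ Y).ncard + (Cᶜ ∩ Y).ncard :=
    add_le_add (Set.ncard_le_ncard hx1) (Set.ncard_le_ncard hx2)
  have hbal := ncard_inter_eq_of_invariant hbip h.1 (C := Cᶜ) fun v => not_congr (hC v)
  have hsplit := Set.ncard_inter_add_ncard_sdiff_eq_ncard X C
  rw [Set.inter_comm, Set.sdiff_eq, Set.inter_comm X Cᶜ, hX] at hsplit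
  have hd := hdeg (σ u) (σ w) (fun h' => hxC (h' ▸ hyC)) (fun h' => hxC (hy1 h').1)
    (fun h' => hxC (hy2 h').1)
  omega

theorem IsMaxCycleFactor.false_of_complete [Finite V] {A : V → V → Prop} {a : ℕ}
    {X Y C : Set V} {σ : Equiv.Perm V} (ha : 0 < a) (hbip : IsBipartition A X Y)
    (hX : X.ncard = a) (hY : Y.ncard = a) (hsc : StronglyConnected A)
    (hdeg : ∀ u v : V, u ≠ v → ¬ A u v → ¬ A v u → 3 * a ≤ deg A u + deg A v)
    (h : IsMaxCycleFactor A σ) (hC : ∀ v, σ v ∈ C ↔ v ∈ C)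
    (hcomp : ∀ u v, (u ∈ C ↔ v ∈ C) → (v ∈ X ↔ u ∉ X) → A u v)
    {p q : V} (hp : p ∈ C) (hq : q ∉ C) : False := by
  obtain ⟨u, hu, v, hv, huv⟩ := hsc.exists_arc_leaving hp hq
  obtain ⟨w, hw, z, hz, hwz⟩ := hsc.exists_arc_leaving (C := Cᶜ) hq (not_not.2 hp)
  rw [Set.notMem_compl_iff] at hz
  have hYX := hbip.mem_right_iff
  by_cases hux : u ∈ X <;> by_cases hwx : w ∈ X
  · exact h.not_crossing hbip hC hcomp hu hv hw hz (iff_of_true hux hwx) huv hwz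
  · exact h.false_of_complete_of_mem ha hbip hX hdeg hC hcomp hu hv hw hz hux ((hYX w).2 hwx)
      huv hwz
  · refine h.false_of_complete_of_mem ha hbip.symm hY hdeg hC (fun u v h1 h2 => hcomp u v h1 ?_)
      hu hv hw hz ((hYX u).2 hux) hwx huv hwz
    rw [hYX, hYX] at h2
    tauto
  · exact h.not_crossing hbip hC hcomp hu hv hw hz (iff_of_false hux hwx) huv hwz

theorem IsMaxCycleFactor.outDeg_add_inDeg_le [Finite V] {A : V → V → Prop} {X Y C : Set V}
    {σ : Equiv.Perm V} (hbip : IsBipartition A X Y) (h : IsMaxCycleFactor A σ)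
    (hC : ∀ v, σ v ∈ C ↔ v ∈ C) {u : V} (hu : u ∈ C) (huX : u ∈ X) :
    outDeg A u + inDeg A (σ u) ≤
      ({v | A u v} ∩ C).ncard + ({v | A v (σ u)} ∩ C).ncard + (X \ C).ncard := by
  have h1 := Set.ncard_inter_add_ncard_sdiff_eq_ncard {v | A u v} C
  have h2 := Set.ncard_inter_add_ncard_sdiff_eq_ncard {v | A v (σ u)} C
  have hpre : ({v | A u v} \ C).ncard = (σ ⁻¹' ({v | A u v} \ C)).ncard :=
    (Set.ncard_preimage_of_injective_subset_range σ.injective (by simp)).symm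
  have hdisj : Disjoint (σ ⁻¹' ({v | A u v} \ C)) ({v | A v (σ u)} \ C) := by
    rw [Set.disjoint_left]
    intro v hv hv'
    exact h.not_arc_and_arc (fun hs => hv'.2 (mem_of_sameCycle hC hs hu)) ⟨hv.1, hv'.1⟩
  have hle : (σ ⁻¹' ({v | A u v} \ C) ∪ ({v | A v (σ u)} \ C)).ncard ≤ (X \ C).ncard := by
    refine Set.ncard_le_ncard ?_
    rintro v (hv | hv)
    · exact ⟨(hbip.head_mem_iff (h.1 v)).1 (hbip.outNbrs_subset huX hv.1),
        fun hvC => hv.2 ((hC v).2 hvC)⟩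
    · exact ⟨hbip.symm.inNbrs_subset ((hbip.head_mem_iff (h.1 u)).2 huX) hv.1, hv.2⟩
  rw [Set.ncard_union_eq hdisj] at hle
  change {v | A u v}.ncard + {v | A v (σ u)}.ncard ≤ _
  omega

theorem mul_card_le_two_mul_sum_of_pairwise {ι : Type*} (S : Finset ι) (f : ι → ℕ) (k : ℕ)
    (hS : 2 ≤ S.card) (hf : ∀ u ∈ S, ∀ v ∈ S, u ≠ v → k ≤ f u + f v) :
    S.card * k ≤ 2 * ∑ u ∈ S, f u := by
  classical
  rw [Finset.mul_sum]
  by_cases hall : ∀ u ∈ S, k ≤ 2 * f u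
  · exact Finset.card_nsmul_le_sum S _ k hall
  · push Not at hall
    obtain ⟨u, hu, hlt⟩ := hall
    have hrest : ∀ v ∈ S.erase u, 2 * k - 2 * f u ≤ 2 * f v := fun v hv => by
      have := hf u hu v (Finset.mem_of_mem_erase hv) (Finset.ne_of_mem_erase hv).symm
      omega
    have h1 := Finset.card_nsmul_le_sum (S.erase u) (fun v => 2 * f v) _ hrest
    rw [← Finset.add_sum_erase S _ hu]
    have h2 := Finset.card_erase_add_one hu
    obtain ⟨m, hm⟩ : ∃ m, (S.erase u).card = m + 1 := ⟨(S.erase u).card - 1, by omega⟩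
    rw [hm] at h1 h2
    rw [← h2]
    obtain ⟨d, hd⟩ : ∃ d, k = 2 * f u + d := ⟨k - 2 * f u, by omega⟩
    have h3 : 2 * k - 2 * f u = k + d := by omega
    rw [h3, smul_eq_mul] at h1
    nlinarith

theorem IsMaxCycleFactor.outDeg_add_inDeg_le_card [Finite V] {A : V → V → Prop} {a n : ℕ}
    {X Y C : Set V} {σ : Equiv.Perm V} (hbip : IsBipartition A X Y) (hX : X.ncard = a)
    (h : IsMaxCycleFactor A σ) (hC : ∀ v, σ v ∈ C ↔ v ∈ C) (hn : (C ∩ X).ncard = n)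
    {u : V} (hu : u ∈ C) (huX : u ∈ X) :
    outDeg A u + inDeg A (σ u) ≤ a + n ∧
      (outDeg A u + inDeg A (σ u) = a + n → ∀ v ∈ C ∩ Y, A u v) := by
  have hnY := (ncard_inter_eq_of_invariant hbip h.1 hC).trans hn
  have h1 := h.outDeg_add_inDeg_le hbip hC hu huX
  have hs1 : {v | A u v} ∩ C ⊆ C ∩ Y := fun v hv => ⟨hv.2, hbip.outNbrs_subset huX hv.1⟩
  have hs2 : {v | A v (σ u)} ∩ C ⊆ C ∩ X := fun v hv =>
    ⟨hv.2, hbip.symm.inNbrs_subset ((hbip.head_mem_iff (h.1 u)).2 huX) hv.1⟩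
  have h2 := Set.ncard_le_ncard hs1
  have h3 := Set.ncard_le_ncard hs2
  have hsplit := Set.ncard_inter_add_ncard_sdiff_eq_ncard X C
  rw [Set.inter_comm, hX] at hsplit
  refine ⟨by omega, fun heq v hv => ?_⟩
  have := Set.eq_of_subset_of_ncard_le hs1 (by omega)
  exact (this.symm ▸ hv : v ∈ {v | A u v} ∩ C).1

/-- Degree counting over the vertices of a union `C` of at least two-by-two cycles. -/
theorem IsMaxCycleFactor.card_le_and_complete [Finite V] {A : V → V → Prop} {a n : ℕ}
    {X Y C : Set V} {σ : Equiv.Perm V} (hbip : IsBipartition A X Y)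
    (hX : X.ncard = a) (hY : Y.ncard = a)
    (hdeg : ∀ u v : V, u ≠ v → ¬ A u v → ¬ A v u → 3 * a ≤ deg A u + deg A v)
    (h : IsMaxCycleFactor A σ) (hC : ∀ v, σ v ∈ C ↔ v ∈ C) (hn : (C ∩ X).ncard = n)
    (hn2 : 2 ≤ n) :
    a ≤ 2 * n ∧ (a = 2 * n → ∀ u ∈ C, ∀ v ∈ C, (v ∈ X ↔ u ∉ X) → A u v) := by
  classical
  have hnY := (ncard_inter_eq_of_invariant hbip h.1 hC).trans hn
  have hYX := hbip.mem_right_iff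
  have hpt : ∀ u ∈ C, outDeg A u + inDeg A (σ u) ≤ a + n ∧
      (outDeg A u + inDeg A (σ u) = a + n → ∀ v ∈ C, (v ∈ X ↔ u ∉ X) → A u v) := by
    intro u hu
    by_cases hux : u ∈ X
    · have := h.outDeg_add_inDeg_le_card hbip hX hC hn hu hux
      exact ⟨this.1, fun heq v hv hvX => this.2 heq v ⟨hv, (hYX v).2 (by tauto)⟩⟩
    · have := h.outDeg_add_inDeg_le_card hbip.symm hY hC hnY hu ((hYX u).2 hux)
      exact ⟨this.1, fun heq v hv hvX => this.2 heq v ⟨hv, hvX.2 hux⟩⟩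
  set S := (Set.toFinite (C ∩ X)).toFinset with hS
  set T := (Set.toFinite (C ∩ Y)).toFinset with hT
  have hScard : S.card = n := by rw [← hn, Set.ncard_eq_toFinset_card (C ∩ X)]
  have hTcard : T.card = n := by rw [← hnY, Set.ncard_eq_toFinset_card (C ∩ Y)]
  have hmS : ∀ u, u ∈ S ↔ u ∈ C ∧ u ∈ X := fun u => by simp [hS]
  have hmT : ∀ u, u ∈ T ↔ u ∈ C ∧ u ∈ Y := fun u => by simp [hT]
  have hdisj : Disjoint S T := Finset.disjoint_left.2 fun u hu hv =>
    (hYX u).1 ((hmT u).1 hv).2 ((hmS u).1 hu).2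
  have hmST : ∀ u, u ∈ S ∪ T ↔ u ∈ C := fun u => by
    rw [Finset.mem_union, hmS, hmT, hYX]; tauto
  have hsumS := mul_card_le_two_mul_sum_of_pairwise S (deg A) (3 * a) (by omega)
    fun u hu v hv huv => hdeg u v huv (hbip.not_arc ((hmS u).1 hu).2 ((hmS v).1 hv).2)
      (hbip.not_arc ((hmS v).1 hv).2 ((hmS u).1 hu).2)
  have hsumT := mul_card_le_two_mul_sum_of_pairwise T (deg A) (3 * a) (by omega)
    fun u hu v hv huv => hdeg u v huv (hbip.symm.not_arc ((hmT u).1 hu).2 ((hmT v).1 hv).2)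
      (hbip.symm.not_arc ((hmT v).1 hv).2 ((hmT u).1 hu).2)
  have hshift : ∑ u ∈ S ∪ T, inDeg A (σ u) = ∑ u ∈ S ∪ T, inDeg A u :=
    Finset.sum_equiv σ (fun u => by rw [hmST, hmST, hC]) fun _ _ => rfl
  have hsum : ∑ u ∈ S ∪ T, (outDeg A u + inDeg A (σ u)) = ∑ u ∈ S, deg A u + ∑ u ∈ T, deg A u := by
    rw [Finset.sum_add_distrib, hshift, ← Finset.sum_add_distrib, ← Finset.sum_union hdisj]
    rfl
  have hcardST : (S ∪ T).card = 2 * n := by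
    rw [Finset.card_union_of_disjoint hdisj]; omega
  have hupper : ∑ u ∈ S ∪ T, (outDeg A u + inDeg A (σ u)) ≤ 2 * n * (a + n) := by
    rw [← hcardST, ← smul_eq_mul]
    exact Finset.sum_le_card_nsmul _ _ _ fun u hu => (hpt u ((hmST u).1 hu)).1
  rw [hScard] at hsumS
  rw [hTcard] at hsumT
  refine ⟨by nlinarith, fun heq u hu => (hpt u hu).2 ?_⟩
  by_contra hne
  have hlt : ∑ u ∈ S ∪ T, (outDeg A u + inDeg A (σ u)) < ∑ _u ∈ S ∪ T, (a + n) :=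
    Finset.sum_lt_sum (fun v hv => (hpt v ((hmST v).1 hv)).1)
      ⟨u, (hmST u).2 hu, lt_of_le_of_ne (hpt u hu).1 hne⟩
  rw [Finset.sum_const, hcardST, smul_eq_mul] at hlt
  subst heq
  nlinarith

theorem outDeg_add_ncard_le [Finite V] {A : V → V → Prop} {X Y M : Set V}
    (hbip : IsBipartition A X Y) {x : V} (hx : x ∈ X) (hM : M ⊆ Y) (hxM : ∀ y ∈ M, ¬ A x y) :
    outDeg A x + M.ncard ≤ Y.ncard := by
  have hdisj : Disjoint {y | A x y} M := Set.disjoint_left.2 fun y hy hyM => hxM y hyM hy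
  rw [outDeg, ← Set.ncard_union_eq hdisj]
  exact Set.ncard_le_ncard (Set.union_subset (hbip.outNbrs_subset hx) hM)

theorem inDeg_add_ncard_le [Finite V] {A : V → V → Prop} {X Y M : Set V}
    (hbip : IsBipartition A X Y) {x : V} (hx : x ∈ X) (hM : M ⊆ Y) (hxM : ∀ y ∈ M, ¬ A y x) :
    inDeg A x + M.ncard ≤ Y.ncard := by
  have hdisj : Disjoint {y | A y x} M := Set.disjoint_left.2 fun y hy hyM => hxM y hyM hy
  rw [inDeg, ← Set.ncard_union_eq hdisj]
  exact Set.ncard_le_ncard (Set.union_subset (hbip.inNbrs_subset hx) hM)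

/-- A two-cycle on vertices of small degree leaves a complete bipartite digraph. -/
theorem complete_of_two_cycle [Finite V] {A : V → V → Prop} {a : ℕ} {X Y : Set V}
    (hbip : IsBipartition A X Y) (hX : X.ncard = a) (hY : Y.ncard = a)
    (hdeg : ∀ u v : V, u ≠ v → ¬ A u v → ¬ A v u → 3 * a ≤ deg A u + deg A v)
    {x y x' y' : V} (hx : x ∈ X) (hy : y ∈ Y) (hxy : A x y) (hyx : A y x)
    (hdx : deg A x ≤ a + 1) (hd : deg A x + deg A y ≤ 2 * a + 2)
    (hx' : x' ∈ X) (hxx' : x' ≠ x) (hy' : y' ∈ Y) (hyy' : y' ≠ y) : A x' y' ∧ A y' x' := by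
  have hout : ∀ u ∈ X, ∀ M ⊆ Y, (∀ y ∈ M, ¬ A u y) → outDeg A u + M.ncard ≤ a :=
    fun u hu M hM h => hY ▸ outDeg_add_ncard_le hbip hu hM h
  have hin : ∀ u ∈ X, ∀ M ⊆ Y, (∀ y ∈ M, ¬ A y u) → inDeg A u + M.ncard ≤ a :=
    fun u hu M hM h => hY ▸ inDeg_add_ncard_le hbip hu hM h
  have hout0 : ∀ u ∈ X, outDeg A u ≤ a := fun u hu => by
    simpa using hout u hu ∅ (by simp) (by simp)
  have hin0 : ∀ u ∈ X, inDeg A u ≤ a := fun u hu => by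
    simpa using hin u hu ∅ (by simp) (by simp)
  have hout1 : ∀ u ∈ X, ∀ v ∈ Y, ¬ A u v → outDeg A u + 1 ≤ a := fun u hu v hv huv => by
    simpa using hout u hu {v} (by simpa) (by simpa)
  have hin1 : ∀ u ∈ X, ∀ v ∈ Y, ¬ A v u → inDeg A u + 1 ≤ a := fun u hu v hv huv => by
    simpa using hin u hu {v} (by simpa) (by simpa)
  have hpair : ({y, y'} : Set V) ⊆ Y := by
    rintro v (rfl | rfl) <;> assumption
  have hout2 : ¬ A x' y → ¬ A x' y' → outDeg A x' + 2 ≤ a := fun h1 h2 => by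
    rw [← Set.ncard_pair hyy'.symm]
    exact hout x' hx' _ hpair (by rintro v (rfl | rfl) <;> assumption)
  have hin2 : ¬ A y x' → ¬ A y' x' → inDeg A x' + 2 ≤ a := fun h1 h2 => by
    rw [← Set.ncard_pair hyy'.symm]
    exact hin x' hx' _ hpair (by rintro v (rfl | rfl) <;> assumption)
  have hdeg' : ∀ u ∈ X, u ≠ x → 3 * a ≤ deg A x + (outDeg A u + inDeg A u) := fun u hu hux =>
    hdeg x u hux.symm (hbip.not_arc hx hu) (hbip.not_arc hu hx)
  have hdx' := hdeg' x' hx' hxx'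
  have ho := hout0 x' hx'
  have hi := hin0 x' hx'
  have hoy' := hout1 x' hx' y' hy'
  have hiy' := hin1 x' hx' y' hy'
  by_contra hcon
  have hda : deg A x = a + 1 := by
    by_contra hne
    by_cases h1 : A x' y'
    · have := hiy' fun h2 => hcon ⟨h1, h2⟩
      omega
    · have := hoy' h1
      omega
  have hx'y : A x' y := by
    by_contra hn
    have h3 := hout1 x' hx' y hy hn
    by_cases h1 : A x' y'
    · have := hiy' fun h2 => hcon ⟨h1, h2⟩
      omega
    · have := hout2 hn h1
      omega
  have hyx' : A y x' := by
    by_contra hn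
    have h3 := hin1 x' hx' y hy hn
    by_cases h1 : A x' y'
    · have := hin2 hn fun h2 => hcon ⟨h1, h2⟩
      omega
    · have := hoy' h1
      omega
  have hunion : X ⊆ {v | A y v} ∪ {v | A v y} := by
    intro u hu
    by_contra hn
    have hn1 : ¬ A y u := fun h => hn (Or.inl h)
    have hn2 : ¬ A u y := fun h => hn (Or.inr h)
    have h1 := hout1 u hu y hy hn2
    have h2 := hin1 u hu y hy hn1
    have h3 := hdeg' u hu (by rintro rfl; exact hn1 hyx)
    omega
  have hinter : ({x, x'} : Set V) ⊆ {v | A y v} ∩ {v | A v y} := by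
    rintro v (rfl | rfl)
    · exact ⟨hyx, hxy⟩
    · exact ⟨hyx', hx'y⟩
  have h1 := Set.ncard_le_ncard hunion
  have h2 := Set.ncard_le_ncard hinter
  have h3 := Set.ncard_union_add_ncard_inter {v | A y v} {v | A v y}
  rw [Set.ncard_pair hxx'.symm] at h2
  have h4 : deg A y = {v | A y v}.ncard + {v | A v y}.ncard := rfl
  omega

theorem IsMaxCycleFactor.complete_of_ncard_eq_one [Finite V] {A : V → V → Prop} {a : ℕ}
    {X Y C : Set V} {σ : Equiv.Perm V} (hbip : IsBipartition A X Y)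
    (hX : X.ncard = a) (hY : Y.ncard = a)
    (hdeg : ∀ u v : V, u ≠ v → ¬ A u v → ¬ A v u → 3 * a ≤ deg A u + deg A v)
    (h : IsMaxCycleFactor A σ) (hC : ∀ v, σ v ∈ C ↔ v ∈ C) (hn : (C ∩ X).ncard = 1) :
    ∀ u v, (u ∈ C ↔ v ∈ C) → (v ∈ X ↔ u ∉ X) → A u v := by
  have hnY := (ncard_inter_eq_of_invariant hbip h.1 hC).trans hn
  have hYX := hbip.mem_right_iff
  obtain ⟨x, hx⟩ := Set.ncard_eq_one.1 hn
  obtain ⟨y, hy⟩ := Set.ncard_eq_one.1 hnY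
  have hmx : ∀ v, v ∈ C ∧ v ∈ X ↔ v = x := fun v => by
    rw [← Set.mem_inter_iff, hx, Set.mem_singleton_iff]
  have hmy : ∀ v, v ∈ C ∧ v ∈ Y ↔ v = y := fun v => by
    rw [← Set.mem_inter_iff, hy, Set.mem_singleton_iff]
  obtain ⟨hxC, hxX⟩ := (hmx x).2 rfl
  obtain ⟨hyC, hyY⟩ := (hmy y).2 rfl
  have hσx : σ x = y := (hmy _).1 ⟨(hC x).2 hxC, (hbip.head_mem_iff (h.1 x)).2 hxX⟩
  have hσy : σ y = x := (hmx _).1 ⟨(hC y).2 hyC, (hbip.symm.head_mem_iff (h.1 y)).2 hyY⟩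
  have hxy : A x y := hσx ▸ h.1 x
  have hyx : A y x := hσy ▸ h.1 y
  have h1 := (h.outDeg_add_inDeg_le_card hbip hX hC hn hxC hxX).1
  have h2 := (h.outDeg_add_inDeg_le_card hbip.symm hY hC hnY hyC hyY).1
  rw [hσx] at h1
  rw [hσy] at h2
  have hd : deg A x + deg A y ≤ 2 * a + 2 := by unfold deg; omega
  have hrest : ∀ x' y', x' ∈ X → x' ≠ x → y' ∈ Y → y' ≠ y → A x' y' ∧ A y' x' := by
    intro x' y' hx' hxx' hy' hyy'
    by_cases hdx : deg A x ≤ a + 1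
    · exact complete_of_two_cycle hbip hX hY hdeg hxX hyY hxy hyx hdx hd hx' hxx' hy' hyy'
    · exact (complete_of_two_cycle hbip.symm hY hX hdeg hyY hxX hyx hxy (by omega) (by omega)
        hy' hyy' hx' hxx').symm
  intro u v huv hpart
  by_cases huC : u ∈ C
  · have hvC := huv.1 huC
    by_cases huX : u ∈ X
    · rw [(hmx u).1 ⟨huC, huX⟩, (hmy v).1 ⟨hvC, (hYX v).2 (by tauto)⟩]
      exact hxy
    · rw [(hmy u).1 ⟨huC, (hYX u).2 huX⟩, (hmx v).1 ⟨hvC, hpart.2 huX⟩]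
      exact hyx
  · have hvC : v ∉ C := fun h => huC (huv.2 h)
    have hne : ∀ w ∉ C, w ≠ x ∧ w ≠ y := fun w hw =>
      ⟨fun h => hw (h ▸ hxC), fun h => hw (h ▸ hyC)⟩
    by_cases huX : u ∈ X
    · exact (hrest u v huX (hne u huC).1 ((hYX v).2 (by tauto)) (hne v hvC).2).1
    · exact (hrest v u (hpart.2 huX) (hne v hvC).1 ((hYX u).2 huX) (hne u huC).2).2

theorem IsMaxCycleFactor.sameCycle [Finite V] {A : V → V → Prop} {a : ℕ}
    {X Y : Set V} {σ : Equiv.Perm V} (ha : 0 < a) (hbip : IsBipartition A X Y)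
    (hX : X.ncard = a) (hY : Y.ncard = a) (hsc : StronglyConnected A)
    (hdeg : ∀ u v : V, u ≠ v → ¬ A u v → ¬ A v u → 3 * a ≤ deg A u + deg A v)
    (h : IsMaxCycleFactor A σ) (p q : V) : σ.SameCycle p q := by
  by_contra hpq
  set C : Set V := {v | σ.SameCycle p v} with hCdef
  have hC : ∀ v, σ v ∈ C ↔ v ∈ C := fun v => Equiv.Perm.sameCycle_apply_right
  have hC' : ∀ v, σ v ∈ Cᶜ ↔ v ∈ Cᶜ := fun v => not_congr (hC v)
  have hp : p ∈ C := Equiv.Perm.SameCycle.refl σ p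
  have hYX := hbip.mem_right_iff
  have hpos : ∀ B : Set V, (∀ v, σ v ∈ B ↔ v ∈ B) → ∀ w ∈ B, 0 < (B ∩ X).ncard := by
    intro B hB w hw
    by_cases hwX : w ∈ X
    · exact (Set.ncard_pos).2 ⟨w, hw, hwX⟩
    · exact (Set.ncard_pos).2
        ⟨σ w, (hB w).2 hw, (hbip.symm.head_mem_iff (h.1 w)).2 ((hYX w).2 hwX)⟩
  have h1 := hpos C hC p hp
  have h2 := hpos Cᶜ hC' q hpq
  have hsplit := Set.ncard_inter_add_ncard_sdiff_eq_ncard X C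
  rw [Set.inter_comm, Set.sdiff_eq, Set.inter_comm X Cᶜ, hX] at hsplit
  refine h.false_of_complete ha hbip hX hY hsc hdeg hC ?_ hp hpq
  by_cases hn1 : (C ∩ X).ncard = 1
  · exact h.complete_of_ncard_eq_one hbip hX hY hdeg hC hn1
  by_cases hn2 : (Cᶜ ∩ X).ncard = 1
  · intro u v huv
    exact h.complete_of_ncard_eq_one hbip hX hY hdeg hC' hn2 u v (not_congr huv)
  have h3 := h.card_le_and_complete hbip hX hY hdeg hC rfl (by omega)
  have h4 := h.card_le_and_complete hbip hX hY hdeg hC' rfl (by omega)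
  intro u v huv hpart
  by_cases hu : u ∈ C
  · exact h3.2 (by omega) u hu v (huv.1 hu) hpart
  · exact h4.2 (by omega) u hu v (fun hv => hu (huv.2 hv)) hpart

/-- Meyniel-type condition on non-adjacent pairs implies hamiltonicity. -/
theorem stmt_0 {V : Type*} [Fintype V] (A : V → V → Prop) (a : ℕ) (X Y : Set V)
    (ha : 2 ≤ a) (hcard : Fintype.card V = 2 * a)
    (hbip : IsBipartition A X Y) (hX : X.ncard = a) (hY : Y.ncard = a)
    (hsc : StronglyConnected A)
    (hdeg : ∀ u v : V, u ≠ v → ¬ A u v → ¬ A v u → 3 * a ≤ deg A u + deg A v) :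
    IsHamiltonian A := by
  have : Nontrivial V := Fintype.one_lt_card_iff_nontrivial.1 (by omega)
  obtain ⟨σ, hσ⟩ :=
    (hasCycleFactor_of_meyniel hbip hX hY hsc hdeg).exists_isMaxCycleFactor
  exact isHamiltonian_of_sameCycle hσ.1
    (hσ.sameCycle (by omega) hbip hX hY hsc hdeg)
end

section
/- Let D be a strongly connected balanced bipartite digraph of order 2a with a ≥ 2, such that d(u)+d(v) ≥ 3a+1 for every dominating pair {u,v} of vertices in D. Then D is Hamiltonian. -/
open Finset Function

variable {V : Type*}

namespace DominatingPair

section Neighbours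

variable {A : V → V → Prop}

/-- In a strongly connected digraph, some arc enters every nonempty proper vertex set. -/
lemma _root_.StronglyConnected.exists_arc_into (hsc : StronglyConnected A)
    (P : Set V) {x y : V} (hx : x ∉ P) (hy : y ∈ P) : ∃ u v, u ∉ P ∧ v ∈ P ∧ A u v := by
  by_contra! h
  have key : ∀ z, Relation.ReflTransGen A x z → z ∉ P := fun z hz => by
    induction hz with
    | refl => exact hx
    | tail _ hbc ih => exact fun hc => h _ _ ih hc hbc
  exact key y (hsc x y) hy

/-- `X` and `Y` are the two partite sets, both of size `a`, of the digraph `A`. -/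
structure IsBalanced (A : V → V → Prop) (X Y : Finset V) (a : ℕ) : Prop where
  disj : Disjoint X Y
  cover : ∀ v, v ∈ X ∨ v ∈ Y
  arc : ∀ u v, A u v → (u ∈ X ∧ v ∈ Y) ∨ (u ∈ Y ∧ v ∈ X)
  card_left : #X = a
  card_right : #Y = a

namespace IsBalanced

variable {X Y : Finset V} {a : ℕ}

lemma symm (hb : IsBalanced A X Y a) : IsBalanced A Y X a where
  disj := hb.disj.symm
  cover v := (hb.cover v).symm
  arc u v h := (hb.arc u v h).symm
  card_left := hb.card_right
  card_right := hb.card_left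

lemma notMem_right (hb : IsBalanced A X Y a) {u : V} (hu : u ∈ X) : u ∉ Y :=
  Finset.disjoint_left.1 hb.disj hu

lemma mem_right_of_arc (hb : IsBalanced A X Y a) {u v : V} (hu : u ∈ X) (h : A u v) : v ∈ Y := by
  rcases hb.arc u v h with h | h
  · exact h.2
  · exact absurd h.1 (hb.notMem_right hu)

lemma mem_left_of_arc (hb : IsBalanced A X Y a) {u v : V} (hv : v ∈ Y) (h : A u v) : u ∈ X := by
  rcases hb.arc u v h with h | h
  · exact h.1
  · exact absurd hv (hb.notMem_right h.2)

lemma exists_out (hb : IsBalanced A X Y a) (ha : 2 ≤ a) (hsc : StronglyConnected A) (u : V) :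
    ∃ v, A u v := by
  obtain ⟨w, -, hw⟩ := exists_mem_ne (s := X) (by rw [hb.card_left]; omega) u
  obtain ⟨x, y, hx, -, hxy⟩ := hsc.exists_arc_into {u}ᶜ (x := u) (y := w) (by simp) (by simpa)
  exact ⟨y, by simp at hx; exact hx ▸ hxy⟩

lemma exists_in (hb : IsBalanced A X Y a) (ha : 2 ≤ a) (hsc : StronglyConnected A) (u : V) :
    ∃ v, A v u := by
  obtain ⟨w, -, hw⟩ := exists_mem_ne (s := X) (by rw [hb.card_left]; omega) u
  obtain ⟨x, y, -, hy, hxy⟩ := hsc.exists_arc_into {u} (x := w) (y := u) (by simpa) (by simp)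
  exact ⟨x, by simp at hy; exact hy ▸ hxy⟩

end IsBalanced

variable [Fintype V]

open Classical in
/-- The finset of out-neighbours. -/
noncomputable def outNbrs (A : V → V → Prop) (u : V) : Finset V := univ.filter (A u)

open Classical in
/-- The finset of in-neighbours. -/
noncomputable def inNbrs (A : V → V → Prop) (u : V) : Finset V := univ.filter (A · u)

@[simp] lemma mem_outNbrs {u v : V} : v ∈ outNbrs A u ↔ A u v := by simp [outNbrs]

@[simp] lemma mem_inNbrs {u v : V} : v ∈ inNbrs A u ↔ A v u := by simp [inNbrs]

lemma deg_eq_card_add_card (u : V) : deg A u = #(outNbrs A u) + #(inNbrs A u) := by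
  classical
  simp only [deg, outDeg, inDeg, Set.ncard_eq_toFinset_card', outNbrs, inNbrs]
  congr 2 <;> ext <;> simp

namespace IsBalanced

variable {X Y : Finset V} {a : ℕ}

lemma outNbrs_subset (hb : IsBalanced A X Y a) {u : V} (hu : u ∈ X) : outNbrs A u ⊆ Y :=
  fun _ hv => hb.mem_right_of_arc hu (mem_outNbrs.1 hv)

lemma inNbrs_subset (hb : IsBalanced A X Y a) {u : V} (hu : u ∈ X) : inNbrs A u ⊆ Y :=
  fun _ hv => hb.symm.mem_left_of_arc hu (mem_inNbrs.1 hv)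

lemma card_outNbrs_le (hb : IsBalanced A X Y a) (u : V) : #(outNbrs A u) ≤ a := by
  rcases hb.cover u with h | h
  · exact hb.card_right ▸ card_le_card (hb.outNbrs_subset h)
  · exact hb.card_left ▸ card_le_card (hb.symm.outNbrs_subset h)

lemma card_inNbrs_le (hb : IsBalanced A X Y a) (u : V) : #(inNbrs A u) ≤ a := by
  rcases hb.cover u with h | h
  · exact hb.card_right ▸ card_le_card (hb.inNbrs_subset h)
  · exact hb.card_left ▸ card_le_card (hb.symm.inNbrs_subset h)

lemma outNbrs_eq (hb : IsBalanced A X Y a) {u : V} (hu : u ∈ X) (h : a ≤ #(outNbrs A u)) :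
    outNbrs A u = Y :=
  eq_of_subset_of_card_le (hb.outNbrs_subset hu) (hb.card_right ▸ h)

end IsBalanced

/-- The degree condition on dominating pairs, in terms of neighbour finsets. -/
def DegreeCondition (A : V → V → Prop) (a : ℕ) : Prop :=
  ∀ u v w : V, u ≠ v → A u w → A v w →
    3 * a + 1 ≤ #(outNbrs A u) + #(inNbrs A u) + (#(outNbrs A v) + #(inNbrs A v))

end Neighbours

section Matching

variable [Fintype V] [DecidableEq V] {A : V → V → Prop} {X Y : Finset V} {a : ℕ}

/-- A minimal set violating Hall's condition cannot exist. -/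
lemma not_minimal_deficient (hb : IsBalanced A X Y a) (ha : 2 ≤ a) (hsc : StronglyConnected A)
    (hdeg : DegreeCondition A a) (S : Finset V) (hSX : S ⊆ X)
    (hmin : ∀ S' ⊂ S, #S' ≤ #(S'.biUnion (outNbrs A))) :
    #S ≤ #(S.biUnion (outNbrs A)) := by
  by_contra! hlt
  set N := S.biUnion (outNbrs A) with hN
  have hNerase : ∀ x ∈ S, (S.erase x).biUnion (outNbrs A) = N ∧ #N + 1 = #S := by
    intro x hx
    have h1 := hmin _ (erase_ssubset hx)
    have h2 : (S.erase x).biUnion (outNbrs A) ⊆ N :=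
      biUnion_subset_biUnion_of_subset_left _ (erase_subset _ _)
    have h3 := card_erase_add_one hx
    have h4 := card_le_card h2
    exact ⟨eq_of_subset_of_card_le h2 (by omega), by omega⟩
  obtain ⟨x₀, hx₀⟩ : S.Nonempty := card_pos.1 (by omega)
  have hcardN : #N + 1 = #S := (hNerase x₀ hx₀).2
  have hout : ∀ x ∈ S, outNbrs A x ⊆ N := fun x hx => subset_biUnion_of_mem _ hx
  have hpartner : ∀ x ∈ S, ∃ x' ∈ S, ∃ w, x ≠ x' ∧ A x w ∧ A x' w := by
    intro x hx
    obtain ⟨w, hw⟩ := hb.exists_out ha hsc x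
    have hwN : w ∈ (S.erase x).biUnion (outNbrs A) := by
      rw [(hNerase x hx).1]; exact hout x hx (by simpa)
    obtain ⟨x', hx', hw'⟩ := mem_biUnion.1 hwN
    exact ⟨x', mem_of_mem_erase hx', w, (ne_of_mem_erase hx').symm, hw, by simpa using hw'⟩
  have hSa : #S ≤ a := hb.card_left ▸ card_le_card hSX
  have hs : a + 3 ≤ 2 * #S := by
    obtain ⟨x', hx', w, hne, h1, h2⟩ := hpartner x₀ hx₀
    have := hdeg _ _ _ hne h1 h2
    have := card_le_card (hout _ hx₀)
    have := card_le_card (hout _ hx')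
    have := hb.card_inNbrs_le x₀
    have := hb.card_inNbrs_le x'
    omega
  have hNY : N ⊆ Y := biUnion_subset.2 fun x hx => hb.outNbrs_subset (hSX hx)
  have hcardT : #(Y \ N) + #N = a := hb.card_right ▸ card_sdiff_add_card_eq_card hNY
  have hcardR : #(X \ S) + #S = a := hb.card_left ▸ card_sdiff_add_card_eq_card hSX
  have hinT : ∀ t ∈ Y \ N, inNbrs A t ⊆ X \ S := by
    intro t ht x hx
    rw [mem_sdiff] at ht ⊢
    rw [mem_inNbrs] at hx
    exact ⟨hb.mem_left_of_arc ht.1 hx, fun hxS => ht.2 (hout x hxS (by simpa))⟩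
  have hTpriv : ∀ t ∈ Y \ N, ∀ t' ∈ Y \ N, ∀ x, A t x → A t' x → t = t' := by
    intro t ht t' ht' x h1 h2
    by_contra hne
    have := hdeg _ _ _ hne h1 h2
    have := card_le_card (hinT _ ht)
    have := card_le_card (hinT _ ht')
    have := hb.card_outNbrs_le t
    have := hb.card_outNbrs_le t'
    omega
  have hinS : ∀ x ∈ S, #(inNbrs A x) ≤ #S := by
    intro x hx
    have h1 : inNbrs A x ⊆ N ∪ (inNbrs A x ∩ (Y \ N)) := by
      intro y hy
      have := hb.inNbrs_subset (hSX hx) hy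
      simp only [mem_union, mem_inter, mem_sdiff]
      tauto
    have h2 : #(inNbrs A x ∩ (Y \ N)) ≤ 1 := by
      refine card_le_one.2 fun t ht t' ht' => ?_
      rw [mem_inter, mem_inNbrs] at ht ht'
      exact hTpriv t ht.2 t' ht'.2 x ht.1 ht'.1
    have := card_le_card h1
    have := card_union_le N (inNbrs A x ∩ (Y \ N))
    omega
  classical
  set T' := (Y \ N).filter (fun t => ∀ x w, A t x → A w x → w = t) with hT'
  have hT'mem : ∀ t ∈ T', ∀ x w, A t x → A w x → w = t := fun t ht => (mem_filter.1 ht).2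
  have hT'sub : T' ⊆ Y \ N := filter_subset _ _
  have hexc : #((Y \ N) \ T') ≤ 1 := by
    have hbig : ∀ t ∈ (Y \ N) \ T', #S + 1 ≤ #(outNbrs A t) := by
      intro t ht
      rw [mem_sdiff, hT', mem_filter] at ht
      obtain ⟨htT, hnot⟩ := ht
      push Not at hnot
      obtain ⟨x, w, h1, h2, hne⟩ := hnot htT
      have := hdeg _ _ _ hne h2 h1
      have := card_le_card (hinT _ htT)
      have := hb.card_outNbrs_le w
      have := hb.card_inNbrs_le w
      omega
    refine card_le_one.2 fun t ht t' ht' => ?_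
    by_contra hne
    have htT := (mem_sdiff.1 ht).1
    have htT' := (mem_sdiff.1 ht').1
    have hdisj : Disjoint (outNbrs A t) (outNbrs A t') := by
      rw [Finset.disjoint_left]
      intro x h1 h2
      exact hne (hTpriv t htT t' htT' x (by simpa using h1) (by simpa using h2))
    have hsub : outNbrs A t ∪ outNbrs A t' ⊆ X :=
      union_subset (hb.symm.outNbrs_subset (mem_sdiff.1 htT).1)
        (hb.symm.outNbrs_subset (mem_sdiff.1 htT').1)
    have h1 := card_le_card hsub
    rw [card_union_of_disjoint hdisj, hb.card_left] at h1
    have := hbig t ht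
    have := hbig t' ht'
    omega
  have hT'out : ∀ t ∈ T', ∀ x, A t x → x ∈ X \ S := by
    intro t ht x hx
    refine mem_sdiff.2 ⟨hb.symm.mem_right_of_arc (mem_sdiff.1 (hT'sub ht)).1 hx, fun hxS => ?_⟩
    have hin : #(inNbrs A x) ≤ 1 := by
      refine card_le_one.2 fun w hw w' hw' => ?_
      rw [mem_inNbrs] at hw hw'
      rw [hT'mem t ht x w hx hw, hT'mem t ht x w' hx hw']
    obtain ⟨x', hx', w, hne, h1, h2⟩ := hpartner x hxS
    have := hdeg _ _ _ hne h1 h2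
    have := card_le_card (hout _ hxS)
    have := card_le_card (hout _ hx')
    have := hinS x' hx'
    omega
  choose g hg using fun t => hb.exists_out ha hsc t
  have hginj : Set.InjOn g T' := fun t ht t' _ h =>
    (hT'mem t ht (g t) t' (hg t) (h ▸ hg t')).symm
  have himg : T'.image g = X \ S := by
    refine eq_of_subset_of_card_le (image_subset_iff.2 fun t ht => hT'out t ht _ (hg t)) ?_
    rw [card_image_of_injOn hginj]
    have := card_sdiff_add_card_eq_card hT'sub
    omega
  obtain ⟨t₀, ht₀⟩ : (Y \ N).Nonempty := card_pos.1 (by omega)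
  obtain ⟨r, hr⟩ := hb.exists_in ha hsc t₀
  have hrR : r ∈ X \ S := hinT t₀ ht₀ (by simpa)
  obtain ⟨u, v, hu, hv, huv⟩ := hsc.exists_arc_into {z | z ∈ X \ S ∨ z ∈ T'} (x := x₀) (y := r)
    (by
      rintro (h | h)
      · exact (mem_sdiff.1 h).2 hx₀
      · exact hb.notMem_right (hSX hx₀) (mem_sdiff.1 (hT'sub h)).1) (Or.inl hrR)
  rcases hv with hv | hv
  · rw [← himg, mem_image] at hv
    obtain ⟨t, ht, rfl⟩ := hv
    exact hu (Or.inr (hT'mem t ht _ u (hg t) huv ▸ ht))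
  · exact hu (Or.inl (hinT v (hT'sub hv) (by simpa)))

lemma card_le_card_biUnion_outNbrs (hb : IsBalanced A X Y a) (ha : 2 ≤ a)
    (hsc : StronglyConnected A) (hdeg : DegreeCondition A a) (S : Finset V) (hSX : S ⊆ X) :
    #S ≤ #(S.biUnion (outNbrs A)) := by
  induction S using Finset.strongInduction with
  | H S ih =>
    exact not_minimal_deficient hb ha hsc hdeg S hSX fun S' hS' => ih S' hS' (hS'.1.trans hSX)

lemma hasCycleFactor (hb : IsBalanced A X Y a) (ha : 2 ≤ a)
    (hsc : StronglyConnected A) (hdeg : DegreeCondition A a) : HasCycleFactor A := by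
  have hall : ∀ S : Finset V, #S ≤ #(S.biUnion (outNbrs A)) := by
    intro S
    have hS : S ∩ X ∪ S ∩ Y = S := by
      rw [← inter_union_distrib_left]
      exact inter_eq_left.2 fun v _ => mem_union.2 (hb.cover v)
    have hd : Disjoint ((S ∩ X).biUnion (outNbrs A)) ((S ∩ Y).biUnion (outNbrs A)) :=
      hb.disj.symm.mono
        (biUnion_subset.2 fun x hx => hb.outNbrs_subset (mem_inter.1 hx).2)
        (biUnion_subset.2 fun x hx => hb.symm.outNbrs_subset (mem_inter.1 hx).2)
    calc #S = #(S ∩ X ∪ S ∩ Y) := by rw [hS]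
      _ ≤ #(S ∩ X) + #(S ∩ Y) := card_union_le _ _
      _ ≤ #((S ∩ X).biUnion (outNbrs A)) + #((S ∩ Y).biUnion (outNbrs A)) := add_le_add
          (card_le_card_biUnion_outNbrs hb ha hsc hdeg _ inter_subset_right)
          (card_le_card_biUnion_outNbrs hb.symm ha hsc hdeg _ inter_subset_right)
      _ = #(S.biUnion (outNbrs A)) := by
          rw [← card_union_of_disjoint hd, ← union_biUnion, hS]
  obtain ⟨f, hf, hfA⟩ := (all_card_le_biUnion_card_iff_exists_injective (outNbrs A)).1 hall
  exact ⟨Equiv.ofBijective f (Finite.injective_iff_bijective.1 hf), fun v => by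
    simpa using hfA v⟩

end Matching

section Merging

open Equiv Equiv.Perm

variable {σ : Perm V} {u v : V}

lemma isHamiltonian_of_sameCycle [Fintype V] [Nonempty V] {A : V → V → Prop}
    (hσ : ∀ v, A v (σ v)) (h : ∀ u v, σ.SameCycle u v) : IsHamiltonian A := by
  obtain ⟨v₀⟩ := ‹Nonempty V›
  have hcyc : σ.IsCycleOn (univ : Finset V) :=
    ⟨by simp, fun x _ y _ => h x y⟩
  have : NeZero (Fintype.card V) := ⟨Fintype.card_ne_zero⟩
  have hmod : ∀ m n, (σ ^ m) v₀ = (σ ^ n) v₀ ↔ m ≡ n [MOD Fintype.card V] := fun m n =>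
    hcyc.pow_apply_eq_pow_apply (mem_univ v₀)
  have hinj : Injective fun i : ZMod (Fintype.card V) => (σ ^ i.val) v₀ := by
    intro i j hij
    have := (hmod _ _).1 hij
    rwa [← ZMod.natCast_eq_natCast_iff, ZMod.natCast_zmod_val, ZMod.natCast_zmod_val] at this
  have hbij := (Fintype.bijective_iff_injective_and_card _).2 ⟨hinj, by simp⟩
  refine ⟨Equiv.ofBijective _ hbij, fun i => ?_⟩
  have : (σ ^ (i + 1).val) v₀ = σ ((σ ^ i.val) v₀) := by
    rw [← Perm.mul_apply, ← pow_succ', hmod, ← ZMod.natCast_eq_natCast_iff]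
    simp
  simp only [Equiv.ofBijective_apply, this]
  exact hσ _

variable [DecidableEq V]

lemma sameCycle_mul_swap [Finite V] (h : ¬ σ.SameCycle u v) : (σ * swap u v).SameCycle u v := by
  have hper : 0 < minimalPeriod σ v :=
    minimalPeriod_pos_of_mem_periodicPts (σ.injective.mem_periodicPts v)
  have key : ∀ n, n + 1 ≤ minimalPeriod σ v → ((σ * swap u v) ^ (n + 1)) u = (σ ^ (n + 1)) v := by
    intro n
    induction n with
    | zero => intro; simp
    | succ n ih =>
      intro hn
      rw [pow_succ', Perm.mul_apply, ih (by omega), pow_succ' σ (n + 1), Perm.mul_apply,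
        Perm.mul_apply, swap_apply_of_ne_of_ne]
      · rintro h'
        exact h (SameCycle.symm ⟨(n + 1 : ℕ), by rwa [zpow_natCast]⟩)
      · intro h'
        have : IsPeriodicPt σ (n + 1) v := by
          rw [IsPeriodicPt, IsFixedPt, iterate_eq_pow]; exact h'
        exact absurd (this.minimalPeriod_le (by omega)) (by omega)
  obtain ⟨n, hn⟩ := Nat.exists_eq_add_one_of_ne_zero hper.ne'
  refine ⟨(n + 1 : ℕ), ?_⟩
  rw [zpow_natCast, key n hn.ge, ← hn]
  have := isPeriodicPt_minimalPeriod σ v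
  rwa [IsPeriodicPt, IsFixedPt, iterate_eq_pow] at this

lemma SameCycle.mul_swap [Finite V] (h : ¬ σ.SameCycle u v) {x y : V} (hxy : σ.SameCycle x y) :
    (σ * swap u v).SameCycle x y := by
  set τ := σ * swap u v with hτ
  have huv : τ.SameCycle u v := sameCycle_mul_swap h
  have step : ∀ z, τ.SameCycle z (σ z) := by
    intro z
    by_cases hzu : z = u
    · subst hzu
      have : τ v = σ z := by simp [hτ]
      rw [← this]
      exact sameCycle_apply_right.2 huv
    by_cases hzv : z = v
    · subst hzv
      have : τ u = σ z := by simp [hτ]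
      rw [← this]
      exact sameCycle_apply_right.2 huv.symm
    have : τ z = σ z := by simp [hτ, swap_apply_of_ne_of_ne hzu hzv]
    rw [← this]
    exact sameCycle_apply_right.2 (SameCycle.refl _ _)
  obtain ⟨n, -, rfl⟩ := hxy.exists_pow_eq'
  induction n with
  | zero => exact SameCycle.refl _ _
  | succ n ih =>
    rw [pow_succ', Perm.mul_apply]
    exact (ih ⟨n, by simp⟩).trans (step _)

/-- A cycle factor that is maximal with respect to merging two of its cycles. -/
lemma exists_unmergeable_cycleFactor [Fintype V] {A : V → V → Prop} (h : HasCycleFactor A) :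
    ∃ σ : Perm V, (∀ v, A v (σ v)) ∧
      ∀ u v, ¬ σ.SameCycle u v → A u (σ v) → ¬ A v (σ u) := by
  classical
  obtain ⟨σ₀, hσ₀⟩ := h
  obtain ⟨σ, hσ, hmax⟩ := exists_max_image (univ.filter fun σ : Perm V => ∀ v, A v (σ v))
    (fun σ => #(univ.filter fun p : V × V => σ.SameCycle p.1 p.2)) ⟨σ₀, by simpa using hσ₀⟩
  simp only [mem_filter, mem_univ, true_and] at hσ hmax
  refine ⟨σ, hσ, fun u v huv h1 h2 => ?_⟩
  refine absurd (hmax (σ * swap u v) fun z => ?_) (not_le.2 (card_lt_card ?_))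
  · rw [Perm.mul_apply]
    by_cases hzu : z = u
    · subst hzu; simpa using h1
    by_cases hzv : z = v
    · subst hzv; simpa using h2
    rw [swap_apply_of_ne_of_ne hzu hzv]
    exact hσ z
  · refine Finset.ssubset_iff_subset_ne.2 ⟨fun p hp => ?_, fun he => ?_⟩
    · simp only [mem_filter, mem_univ, true_and] at hp ⊢
      exact SameCycle.mul_swap huv hp
    · have : (u, v) ∈ univ.filter fun p : V × V => σ.SameCycle p.1 p.2 := by
        rw [he]; simpa using sameCycle_mul_swap huv
      exact huv (by simpa using this)

end Merging

section Counting

open Equiv Equiv.Perm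

variable {A : V → V → Prop} {X Y : Finset V} {a : ℕ} {σ : Perm V}

lemma IsBalanced.apply_mem_right (hb : IsBalanced A X Y a) (hσ : ∀ v, A v (σ v)) {v : V}
    (hv : v ∈ X) : σ v ∈ Y := hb.mem_right_of_arc hv (hσ v)

lemma IsBalanced.mem_left_of_apply (hb : IsBalanced A X Y a) (hσ : ∀ v, A v (σ v)) {v : V}
    (hv : σ v ∈ Y) : v ∈ X := hb.mem_left_of_arc hv (hσ v)

/-- The permutation `σ` maps the part of `C` in `X` onto its part in `Y`. -/
lemma image_inter_eq [DecidableEq V] {C : Finset V} (hb : IsBalanced A X Y a) (hσ : ∀ v, A v (σ v))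
    (hC : ∀ v, σ v ∈ C ↔ v ∈ C) : (C ∩ X).image σ = C ∩ Y := by
  ext y
  obtain ⟨y, rfl⟩ := σ.surjective y
  simp only [mem_image, mem_inter, EmbeddingLike.apply_eq_iff_eq, exists_eq_right, hC]
  exact and_congr_right fun _ => ⟨hb.apply_mem_right hσ, hb.mem_left_of_apply hσ⟩

variable [Fintype V]

lemma eq_apply_of_unique_inNbr (hb : IsBalanced A X Y a) (hdeg : DegreeCondition A a)
    (hσ : ∀ v, A v (σ v)) (hm : ∀ u v, ¬ σ.SameCycle u v → A u (σ v) → ¬ A v (σ u))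
    (hns : ∀ u, ∃ v, ¬ σ.SameCycle u v) {x : V} (hxX : σ x ∈ X)
    (hx : ∀ w, A w (σ x) → w = x) {w : V} (hw : A w (σ (σ x))) : w = σ x := by
  by_contra hne
  have hin : #(inNbrs A (σ x)) ≤ 1 := by
    refine card_le_one.2 fun w hw w' hw' => ?_
    rw [hx w (by simpa using hw), hx w' (by simpa using hw')]
  have hout := hb.card_outNbrs_le (σ x)
  have h1 := hdeg _ _ _ hne hw (hσ _)
  have h2 := hb.card_outNbrs_le w
  have h3 := hb.card_inNbrs_le w
  have hfull := hb.outNbrs_eq hxX (by omega)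
  obtain ⟨v, hvX, hv⟩ : ∃ v ∈ X, ¬ σ.SameCycle (σ x) v := by
    obtain ⟨v, hv⟩ := hns (σ x)
    rcases hb.cover v with h | h
    · exact ⟨v, h, hv⟩
    · exact ⟨σ v, hb.symm.apply_mem_right hσ h, by rwa [sameCycle_apply_right]⟩
  have hxv : A (σ x) (σ v) := by
    rw [← mem_outNbrs (A := A), hfull]; exact hb.apply_mem_right hσ hvX
  have h4 := hdeg (σ x) v (σ v) (fun h => hv (h ▸ SameCycle.refl _ _)) hxv (hσ v)
  have h5 := hb.card_inNbrs_le v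
  have hfull' := hb.outNbrs_eq hvX (by omega)
  refine hm _ _ hv hxv ?_
  rw [← mem_outNbrs (A := A), hfull']
  exact hb.apply_mem_right hσ hxX

/-- In an unmergeable cycle factor with several cycles, no vertex has in-degree one. -/
lemma exists_ne_arc_apply (hb : IsBalanced A X Y a) (hsc : StronglyConnected A)
    (hdeg : DegreeCondition A a) (hσ : ∀ v, A v (σ v))
    (hm : ∀ u v, ¬ σ.SameCycle u v → A u (σ v) → ¬ A v (σ u))
    (hns : ∀ u, ∃ v, ¬ σ.SameCycle u v) (u : V) : ∃ w, w ≠ u ∧ A w (σ u) := by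
  by_contra! h
  have key : ∀ x, σ.SameCycle u x → ∀ w, A w (σ x) → w = x := by
    intro x hx
    obtain ⟨n, -, rfl⟩ := hx.exists_pow_eq'
    clear hx
    induction n with
    | zero => exact fun w hw => by_contra fun hne => h w hne hw
    | succ n ih =>
      intro w hw
      rw [pow_succ', Perm.mul_apply] at hw ⊢
      rcases hb.cover (σ ((σ ^ n) u)) with hX | hY
      · exact eq_apply_of_unique_inNbr hb hdeg hσ hm hns hX ih hw
      · exact eq_apply_of_unique_inNbr hb.symm hdeg hσ hm hns hY ih hw
  obtain ⟨v, hv⟩ := hns u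
  obtain ⟨w, y, hw, hy, hwy⟩ :=
    hsc.exists_arc_into {z | σ.SameCycle u z} (x := v) (y := u) hv (SameCycle.refl _ _)
  obtain ⟨y, rfl⟩ := σ.surjective y
  rw [Set.mem_ofPred_eq, sameCycle_apply_right] at hy
  exact hw (key y hy w hwy ▸ hy)

lemma lt_card_outNbrs_add_card_inNbrs (hb : IsBalanced A X Y a) (hdeg : DegreeCondition A a)
    (hσ : ∀ v, A v (σ v)) {u : V} (hu : ∃ w, w ≠ u ∧ A w (σ u)) :
    a + 1 ≤ #(outNbrs A u) + #(inNbrs A u) := by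
  obtain ⟨w, hne, hw⟩ := hu
  have := hdeg _ _ _ hne hw (hσ u)
  have := hb.card_outNbrs_le w
  have := hb.card_inNbrs_le w
  omega

variable [DecidableEq V] {C : Finset V}

/-- Unmergeability bounds the number of arcs joining `u` and its successor on the cycle `C`
to the rest of the digraph. -/
lemma card_outNbrs_add_card_inNbrs_apply_le (hb : IsBalanced A X Y a) (hσ : ∀ v, A v (σ v))
    (hC : ∀ v, σ v ∈ C ↔ v ∈ C) (hm : ∀ u ∈ C, ∀ v ∉ C, A u (σ v) → ¬ A v (σ u))
    {u : V} (hu : u ∈ C ∩ X) :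
    #(outNbrs A u) + #(inNbrs A (σ u)) + #(C ∩ X) ≤
      #(outNbrs A u ∩ C) + #(inNbrs A (σ u) ∩ C) + a := by
  rw [mem_inter] at hu
  have hdisj : Disjoint ((outNbrs A u \ C).image σ.symm) (inNbrs A (σ u) \ C) := by
    rw [Finset.disjoint_left]
    intro v hv hv'
    obtain ⟨z, hz, rfl⟩ := mem_image.1 hv
    rw [mem_sdiff] at hz hv'
    exact hm u hu.1 _ hv'.2 (by simpa using hz.1) (by simpa using hv'.1)
  have hsub : (outNbrs A u \ C).image σ.symm ∪ inNbrs A (σ u) \ C ⊆ X \ C := by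
    refine union_subset (fun v hv => ?_)
      (sdiff_subset_sdiff (hb.symm.inNbrs_subset (hb.apply_mem_right hσ hu.2)) subset_rfl)
    obtain ⟨z, hz, rfl⟩ := mem_image.1 hv
    obtain ⟨z, rfl⟩ := σ.surjective z
    rw [mem_sdiff, hC] at hz
    rw [symm_apply_apply, mem_sdiff]
    exact ⟨hb.mem_left_of_apply hσ (hb.outNbrs_subset hu.2 hz.1), hz.2⟩
  have h1 := card_le_card hsub
  rw [card_union_of_disjoint hdisj, card_image_of_injective _ σ.symm.injective] at h1
  have h2 := card_sdiff_add_card_inter X C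
  have h3 := card_sdiff_add_card_inter (outNbrs A u) C
  have h4 := card_sdiff_add_card_inter (inNbrs A (σ u)) C
  rw [hb.card_left, inter_comm X C] at h2
  omega

lemma sum_outNbrs_inter_eq (hb : IsBalanced A X Y a) :
    ∑ u ∈ C ∩ X, #(outNbrs A u ∩ C) = ∑ y ∈ C ∩ Y, #(inNbrs A y ∩ C) := by
  classical
  have h := sum_card_bipartiteAbove_eq_sum_card_bipartiteBelow A (s := C ∩ X) (t := C ∩ Y)
  refine (sum_congr rfl fun u hu => ?_).trans (h.trans (sum_congr rfl fun y hy => ?_))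
  · congr 1
    ext y
    simp only [mem_inter, mem_outNbrs, mem_bipartiteAbove] at hu ⊢
    exact ⟨fun h => ⟨⟨h.2, hb.mem_right_of_arc hu.2 h.1⟩, h.1⟩, fun h => ⟨h.2, h.1.1⟩⟩
  · congr 1
    ext u
    simp only [mem_inter, mem_inNbrs, mem_bipartiteBelow] at hy ⊢
    exact ⟨fun h => ⟨h.2, h.1.1⟩, fun h => ⟨⟨h.2, hb.mem_left_of_arc hy.2 h.1⟩, h.1⟩⟩

/-- Upper bound for the degrees along arcs leaving `X` in a cycle `C` that cannot be merged. -/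
lemma sum_card_outNbrs_add_sum_card_inNbrs_le (hb : IsBalanced A X Y a) (hσ : ∀ v, A v (σ v))
    (hC : ∀ v, σ v ∈ C ↔ v ∈ C) (hm : ∀ u ∈ C, ∀ v ∉ C, A u (σ v) → ¬ A v (σ u)) :
    ∑ u ∈ C ∩ X, #(outNbrs A u) + ∑ y ∈ C ∩ Y, #(inNbrs A y) + #(C ∩ X) * #(C ∩ X) ≤
      2 * ∑ u ∈ C ∩ X, #(outNbrs A u ∩ C) + #(C ∩ X) * a := by
  have h := sum_le_sum fun u (hu : u ∈ C ∩ X) =>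
    card_outNbrs_add_card_inNbrs_apply_le hb hσ hC hm hu
  simp only [sum_add_distrib, sum_const, smul_eq_mul] at h
  have hre : ∀ f : V → ℕ, ∑ u ∈ C ∩ X, f (σ u) = ∑ y ∈ C ∩ Y, f y := fun f => by
    rw [← image_inter_eq hb hσ hC, sum_image σ.injective.injOn]
  rw [hre fun y => #(inNbrs A y), hre fun y => #(inNbrs A y ∩ C), ← sum_outNbrs_inter_eq hb] at h
  omega

/-- Lower bound for the degrees of the vertices of `X` in a cycle `C` of length at least four. -/
lemma lt_sum_card_outNbrs_add_card_inNbrs (hb : IsBalanced A X Y a) (hdeg : DegreeCondition A a)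
    (hσ : ∀ v, A v (σ v)) (hC : ∀ v, σ v ∈ C ↔ v ∈ C)
    (hin : ∀ u, ∃ w, w ≠ u ∧ A w (σ u)) (hC2 : 2 ≤ #(C ∩ X)) (hCa : 2 * #(C ∩ X) ≤ a) :
    2 * ∑ u ∈ C ∩ X, #(outNbrs A u ∩ C) + #(C ∩ X) * a <
      ∑ u ∈ C ∩ X, (#(outNbrs A u) + #(inNbrs A u)) + #(C ∩ X) * #(C ∩ X) := by
  set d : V → ℕ := fun u => #(outNbrs A u) + #(inNbrs A u) with hd
  set b := #(C ∩ X) with hbdef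
  have hbY : #(C ∩ Y) = b := by
    rw [← image_inter_eq hb hσ hC, card_image_of_injective _ σ.injective]
  have hlow : ∀ u, a + 1 ≤ d u := fun u => lt_card_outNbrs_add_card_inNbrs hb hdeg hσ (hin u)
  have hsubY : ∀ u ∈ C ∩ X, outNbrs A u ∩ C ⊆ C ∩ Y := fun u hu => by
    rw [inter_comm C Y]
    exact inter_subset_inter_right (hb.outNbrs_subset (mem_inter.1 hu).2)
  have hpC : ∀ u ∈ C ∩ X, #(outNbrs A u ∩ C) ≤ b := fun u hu =>
    hbY ▸ card_le_card (hsubY u hu)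
  set L := (C ∩ X).filter (fun u => 2 * d u ≤ 3 * a) with hL
  have hLsub : L ⊆ C ∩ X := filter_subset _ _
  have hLd : ∀ u ∈ L, 2 * d u ≤ 3 * a := fun u hu => (mem_filter.1 hu).2
  have hH : ∀ u ∈ (C ∩ X) \ L, 3 * a + 1 ≤ 2 * d u := fun u hu => by
    rw [mem_sdiff, hL, mem_filter, not_and, not_le] at hu
    exact hu.2 hu.1
  have hcardH : #((C ∩ X) \ L) + #L = b := card_sdiff_add_card_eq_card hLsub
  have hdH : #((C ∩ X) \ L) * (3 * a + 1) ≤ 2 * ∑ u ∈ (C ∩ X) \ L, d u := by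
    rw [mul_sum, ← smul_eq_mul]
    exact card_nsmul_le_sum _ _ _ hH
  have hdL : #L * (a + 1) ≤ ∑ u ∈ L, d u := by
    rw [← smul_eq_mul]
    exact card_nsmul_le_sum _ _ _ fun u _ => hlow u
  have heH : ∑ u ∈ (C ∩ X) \ L, #(outNbrs A u ∩ C) ≤ #((C ∩ X) \ L) * b := by
    rw [← smul_eq_mul]
    exact sum_le_card_nsmul _ _ _ fun u hu => hpC u (mem_sdiff.1 hu).1
  have heL : ∑ u ∈ L, #(outNbrs A u ∩ C) ≤ b := by
    rw [← card_biUnion, ← hbY]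
    · exact card_le_card (biUnion_subset.2 fun u hu => hsubY u (hLsub hu))
    · intro u hu u' hu' hne
      rw [Function.onFun, Finset.disjoint_left]
      intro y hy hy'
      rw [mem_inter, mem_outNbrs] at hy hy'
      have := hdeg _ _ _ hne hy.1 hy'.1
      have h1 := hLd u hu
      have h2 := hLd u' hu'
      simp only [hd] at h1 h2
      omega
  have hsumd := sum_sdiff (f := d) hLsub
  have hsume := sum_sdiff (f := fun u => #(outNbrs A u ∩ C)) hLsub
  obtain hl | hl | hl : #L = 0 ∨ #L = 1 ∨ 2 ≤ #L := by omega
  · rw [card_eq_zero] at hl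
    rw [hl] at hsumd hsume hcardH hdH heH
    simp only [sdiff_empty, add_zero, card_empty] at hcardH hdH heH
    rw [← hbdef] at hdH heH
    nlinarith
  · obtain ⟨u, hu⟩ := card_eq_one.1 hl
    have huX : u ∈ C ∩ X := hLsub (hu ▸ mem_singleton_self u)
    have hu' : (C ∩ X) \ L = (C ∩ X).erase u := by rw [hu, sdiff_singleton_eq_erase]
    rw [hu', hu, sum_singleton] at hsumd hsume
    rw [hu'] at hdH hcardH hH
    by_cases hw : ∃ w ∈ (C ∩ X).erase u, A w (σ u)
    · obtain ⟨w, hwX, hw⟩ := hw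
      have hsum := hdeg _ _ _ (ne_of_mem_erase hwX) hw (hσ u)
      have hrest : #(((C ∩ X).erase u).erase w) * (3 * a + 1) ≤
          2 * ∑ u ∈ ((C ∩ X).erase u).erase w, d u := by
        rw [mul_sum, ← smul_eq_mul]
        exact card_nsmul_le_sum _ _ _ fun v hv => hH v (mem_of_mem_erase hv)
      have hcard := card_erase_add_one hwX
      have hsum' := sum_erase_add _ d hwX
      have he := sum_le_card_nsmul _ _ _ hpC
      rw [smul_eq_mul, ← hbdef] at he
      have hwu : 3 * a + 1 ≤ d w + d u := hsum
      have hb2 : #(((C ∩ X).erase u).erase w) + 2 = b := by omega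
      nlinarith
    · push Not at hw
      have he : ∑ v ∈ (C ∩ X).erase u, #(outNbrs A v ∩ C) ≤ #((C ∩ X).erase u) * (b - 1) := by
        rw [← smul_eq_mul]
        refine sum_le_card_nsmul _ _ _ fun v hv => ?_
        have hsu : σ u ∈ C ∩ Y := by
          rw [← image_inter_eq hb hσ hC]; exact mem_image_of_mem _ huX
        rw [← hbY, ← card_erase_of_mem hsu]
        refine card_le_card fun y hy => mem_erase.2 ⟨?_, hsubY v (mem_of_mem_erase hv) hy⟩
        rintro rfl
        exact hw v hv (by simpa using (mem_inter.1 hy).1)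
      have hpu := hpC u huX
      have hlu := hlow u
      obtain ⟨c, hc⟩ : ∃ c, b = c + 2 := ⟨b - 2, by omega⟩
      obtain ⟨r, hr⟩ : ∃ r, a = 2 * b + r := ⟨a - 2 * b, by omega⟩
      have hc1 : #((C ∩ X).erase u) = c + 1 := by omega
      have hc2 : b - 1 = c + 1 := by omega
      rw [hc1] at hdH he
      rw [hc2] at he
      rw [← hsumd, ← hsume]
      rw [hc] at hpu hr ⊢
      rw [hr] at hlu hdH ⊢
      nlinarith [Nat.zero_le (r * c)]
  · obtain ⟨r, hr⟩ : ∃ r, a = 2 * b + r := ⟨a - 2 * b, by omega⟩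
    obtain ⟨l, hl'⟩ : ∃ l, #L = l + 2 := ⟨#L - 2, by omega⟩
    rw [← hsumd, ← hsume]
    generalize #((C ∩ X) \ L) = h at *
    rw [hl'] at hcardH hdL
    nlinarith [Nat.zero_le (h * r), Nat.zero_le (l * b)]

/-- A vertex on a two-cycle that cannot be merged has no out-neighbour off that cycle. -/
lemma mem_of_arc_of_card_inter_eq_one (hb : IsBalanced A X Y a) (hdeg : DegreeCondition A a)
    (hσ : ∀ v, A v (σ v)) (hC : ∀ v, σ v ∈ C ↔ v ∈ C)
    (hm : ∀ u ∈ C, ∀ v ∉ C, A u (σ v) → ¬ A v (σ u))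
    (hin : ∀ u, ∃ w, w ≠ u ∧ A w (σ u)) (hC1 : #(C ∩ X) = 1) {x z : V} (hx : x ∈ C ∩ X)
    (hz : A x z) : z ∈ C := by
  by_contra hzC
  obtain ⟨v, rfl⟩ := σ.surjective z
  have hxX := (mem_inter.1 hx).2
  have hxC := (mem_inter.1 hx).1
  have hC1' : #(C ∩ Y) = 1 := by
    rw [← image_inter_eq hb hσ hC, card_image_of_injective _ σ.injective, hC1]
  have hy : σ x ∈ C ∩ Y := by rw [← image_inter_eq hb hσ hC]; exact mem_image_of_mem _ hx
  have hyy : σ (σ x) = x := by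
    refine card_le_one.1 hC1.le _ ?_ _ hx
    rw [← image_inter_eq hb.symm hσ hC]; exact mem_image_of_mem _ hy
  have h1 := card_outNbrs_add_card_inNbrs_apply_le hb hσ hC hm hx
  have h2 := card_outNbrs_add_card_inNbrs_apply_le hb.symm hσ hC hm hy
  have hle : ∀ {Z S : Finset V}, #(C ∩ Z) = 1 → S ⊆ Z → #(S ∩ C) ≤ 1 := fun hZ hS => by
    rw [← hZ, inter_comm C]
    exact card_le_card (inter_subset_inter_right hS)
  have hyY := (mem_inter.1 hy).2
  have h3 := hle hC1' (hb.outNbrs_subset hxX)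
  have h4 := hle hC1 (hb.symm.inNbrs_subset hyY)
  have h5 := hle hC1 (hb.symm.outNbrs_subset hyY)
  have h6 := hle hC1' (hb.inNbrs_subset hxX)
  rw [hyy] at h2
  have h7 := lt_card_outNbrs_add_card_inNbrs hb hdeg hσ (hin x)
  have h8 := lt_card_outNbrs_add_card_inNbrs hb hdeg hσ (hin (σ x))
  have hvC : v ∉ C := by rwa [hC] at hzC
  have h9 := hdeg x v (σ v) (fun h => hvC (h ▸ hxC)) hz (hσ v)
  have h10 := hb.card_inNbrs_le v
  have hvX : v ∈ X := hb.mem_left_of_apply hσ (hb.mem_right_of_arc hxX hz)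
  have hfull := hb.outNbrs_eq hvX (by omega)
  refine hm x hxC v hvC hz ?_
  rwa [← mem_outNbrs (A := A), hfull]

/-- An unmergeable cycle factor consists of a single cycle. -/
lemma sameCycle_of_unmergeable (hb : IsBalanced A X Y a) (hsc : StronglyConnected A)
    (hdeg : DegreeCondition A a) (hσ : ∀ v, A v (σ v))
    (hm : ∀ u v, ¬ σ.SameCycle u v → A u (σ v) → ¬ A v (σ u)) (u v : V) : σ.SameCycle u v := by
  classical
  by_contra huv
  have hns : ∀ u, ∃ v, ¬ σ.SameCycle u v := by
    by_contra! h
    obtain ⟨w, hw⟩ := h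
    exact huv ((hw u).symm.trans (hw v))
  have hin := exists_ne_arc_apply hb hsc hdeg hσ hm hns
  let cyc : V → Finset V := fun u => univ.filter (σ.SameCycle u)
  have hmem : ∀ x y, y ∈ cyc x ↔ σ.SameCycle x y := fun x y => by simp [cyc]
  have hcardV : #(univ : Finset V) = 2 * a := by
    have : (univ : Finset V) = X ∪ Y := by ext v; simpa using hb.cover v
    rw [this, card_union_of_disjoint hb.disj, hb.card_left, hb.card_right, two_mul]
  obtain ⟨x, hx⟩ : ∃ x, #(cyc x) ≤ a := by
    by_contra! h
    have hdisj : Disjoint (cyc u) (cyc v) := by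
      rw [Finset.disjoint_left]
      intro w h1 h2
      rw [hmem] at h1 h2
      exact huv (h1.trans h2.symm)
    have h1 := card_le_univ (cyc u ∪ cyc v)
    rw [card_union_of_disjoint hdisj, ← Finset.card_univ, hcardV] at h1
    have := h u
    have := h v
    omega
  set C := cyc x with hCdef
  have hC : ∀ v, σ v ∈ C ↔ v ∈ C := fun v => by rw [hmem, hmem, sameCycle_apply_right]
  have hmC : ∀ u ∈ C, ∀ v ∉ C, A u (σ v) → ¬ A v (σ u) := fun u hu v hv =>
    hm u v fun h => hv ((hmem _ _).2 (((hmem _ _).1 hu).trans h))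
  have hbY : #(C ∩ Y) = #(C ∩ X) := by
    rw [← image_inter_eq hb hσ hC, card_image_of_injective _ σ.injective]
  have hcardC : #(C ∩ X) + #(C ∩ Y) = #C := by
    rw [← card_union_of_disjoint (hb.disj.mono inter_subset_right inter_subset_right),
      ← inter_union_distrib_left]
    congr 1
    exact inter_eq_left.2 fun v _ => mem_union.2 (hb.cover v)
  have hxC : x ∈ C := (hmem _ _).2 (SameCycle.refl _ _)
  have hpos : 0 < #C := card_pos.2 ⟨x, hxC⟩
  obtain h1 | h2 : #(C ∩ X) = 1 ∨ 2 ≤ #(C ∩ X) := by omega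
  · obtain ⟨y, hy⟩ := hns x
    obtain ⟨z, w, hz, hw, hzw⟩ := hsc.exists_arc_into {z | z ∉ C} (x := x) (y := y)
      (by simpa using hxC) (by rwa [Set.mem_ofPred_eq, hmem])
    have hz : z ∈ C := by simpa using hz
    rcases hb.cover z with hX | hY
    · exact hw (mem_of_arc_of_card_inter_eq_one hb hdeg hσ hC hmC hin h1
        (mem_inter.2 ⟨hz, hX⟩) hzw)
    · exact hw (mem_of_arc_of_card_inter_eq_one hb.symm hdeg hσ hC hmC hin (hbY.trans h1)
        (mem_inter.2 ⟨hz, hY⟩) hzw)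
  · have hl1 := lt_sum_card_outNbrs_add_card_inNbrs hb hdeg hσ hC hin h2 (by omega)
    have hl2 := lt_sum_card_outNbrs_add_card_inNbrs hb.symm hdeg hσ hC hin (by omega) (by omega)
    have hu1 := sum_card_outNbrs_add_sum_card_inNbrs_le hb hσ hC hmC
    have hu2 := sum_card_outNbrs_add_sum_card_inNbrs_le hb.symm hσ hC hmC
    rw [sum_add_distrib] at hl1 hl2
    omega

end Counting

end DominatingPair

/-- `d(u)+d(v) ≥ 3a+1` on dominating pairs implies hamiltonicity. -/
theorem stmt_2 {V : Type*} [Fintype V] (A : V → V → Prop) (a : ℕ) (X Y : Set V)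
    (ha : 2 ≤ a) (hcard : Fintype.card V = 2 * a)
    (hbip : IsBipartition A X Y) (hX : X.ncard = a) (hY : Y.ncard = a)
    (hsc : StronglyConnected A)
    (hdeg : ∀ u v : V, IsDominatingPair A u v → 3 * a + 1 ≤ deg A u + deg A v) :
    IsHamiltonian A := by
  classical
  obtain ⟨hdisj, hcov, harc⟩ := hbip
  have hb : DominatingPair.IsBalanced A X.toFinset Y.toFinset a :=
    { disj := Set.disjoint_toFinset.2 hdisj
      cover := fun v => by simpa [← hcov] using Set.mem_univ v
      arc := fun u v h => by simpa using harc u v h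
      card_left := by rw [← Set.ncard_eq_toFinset_card', hX]
      card_right := by rw [← Set.ncard_eq_toFinset_card', hY] }
  have hdeg' : DominatingPair.DegreeCondition A a := fun u v w hne hu hv => by
    simpa only [DominatingPair.deg_eq_card_add_card] using hdeg u v ⟨hne, w, hu, hv⟩
  have : Nonempty V := Fintype.card_pos_iff.1 (by omega)
  obtain ⟨σ, hσ, hm⟩ := DominatingPair.exists_unmergeable_cycleFactor
    (DominatingPair.hasCycleFactor hb ha hsc hdeg')
  exact DominatingPair.isHamiltonian_of_sameCycle hσ
    (DominatingPair.sameCycle_of_unmergeable hb hsc hdeg' hσ hm)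
end
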